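/- arXiv:0909.4577 — 2 statements merged into one kernel-verified Lean document; each statement's English description precedes it below -/
import Mathlib

section
/- Let G be a bicyclic graph with 6 vertices and matching number 3. Then χ(G) ≥ 4/√7 + 1/√6 + 1, with equality if and only if G is isomorphic to B_{6,3}. -/
open SimpleGraph

/-- The degree of a vertex (stated via `Set.ncard`, so no decidability assumptions). -/
noncomputable def degR {V : Type*} (G : SimpleGraph V) (v : V) : ℕ :=
  (G.neighborSet v).ncard

/-- The sum-connectivity index `χ(G) = ∑_{uv ∈ E(G)} 1/√(d_G(u)+d_G(v))`. -/
noncomputable def sumConn {V : Type*} [Fintype V] (G : SimpleGraph V) : ℝ :=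
  ∑ e ∈ G.edgeSet.toFinite.toFinset,
    Sym2.lift ⟨fun u v => (1 : ℝ) / Real.sqrt ((degR G u : ℝ) + (degR G v : ℝ)),
      fun u v => by simp [add_comm]⟩ e

/-- The matching number: the maximum size of a set of pairwise non-adjacent edges. -/
noncomputable def matchingNumber {V : Type*} (G : SimpleGraph V) : ℕ :=
  sSup {k | ∃ M : Set (Sym2 V), M ⊆ G.edgeSet ∧
    M.Pairwise (fun e f => ∀ v, v ∈ e → v ∉ f) ∧ M.ncard = k}

/-- Vertex type of the graph `B_{n,m}`. -/
def BnmVert (n m : ℕ) : Type := Unit ⊕ Fin 4 ⊕ Fin (n - 2 * m + 1) ⊕ (Fin (m - 3) × Fin 2)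

instance (n m : ℕ) : Fintype (BnmVert n m) := by unfold BnmVert; infer_instance

def BnmRel (n m : ℕ) : BnmVert n m → BnmVert n m → Prop
  | Sum.inl _, Sum.inr (Sum.inl _) => True
  | Sum.inl _, Sum.inr (Sum.inr (Sum.inl _)) => True
  | Sum.inl _, Sum.inr (Sum.inr (Sum.inr (_, j))) => j = 0
  | Sum.inr (Sum.inl i), Sum.inr (Sum.inl i') => (i = 0 ∧ i' = 1) ∨ (i = 2 ∧ i' = 3)
  | Sum.inr (Sum.inr (Sum.inr (k, j))), Sum.inr (Sum.inr (Sum.inr (k', j'))) =>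
      k = k' ∧ j = 0 ∧ j' = 1
  | _, _ => False

/-- The graph `B_{n,m}`: two triangles sharing a common vertex (`Sum.inl ()`), with
`n - 2m + 1` pendent vertices and `m - 3` paths on two vertices attached to the
common vertex. -/
def BnmGraph (n m : ℕ) : SimpleGraph (BnmVert n m) := SimpleGraph.fromRel (BnmRel n m)

/-- The tangent line bound for the convex function `s ↦ 1 / √s` at `s = r ^ 2`. -/
lemma tangent_le_one_div_sqrt {r s : ℝ} (hr : 0 < r) (hs : 0 < s) :
    (3 - s / r ^ 2) / (2 * r) ≤ 1 / √s := by
  obtain ⟨t, ht, rfl⟩ : ∃ t : ℝ, 0 < t ∧ s = t ^ 2 :=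
    ⟨√s, Real.sqrt_pos.2 hs, (Real.sq_sqrt hs.le).symm⟩
  rw [Real.sqrt_sq ht.le, div_le_div_iff₀ (by positivity) ht]
  have key : 1 * (2 * r) - (3 - t ^ 2 / r ^ 2) * t = (t - r) ^ 2 * (t + 2 * r) / r ^ 2 := by
    field_simp
    ring
  have : 0 ≤ (t - r) ^ 2 * (t + 2 * r) / r ^ 2 := by positivity
  linarith

lemma degR_eq_degree {V : Type*} (G : SimpleGraph V) (v : V) [Fintype (G.neighborSet v)] :
    degR G v = G.degree v := by
  rw [degR, Set.ncard_eq_toFinset_card', ← G.card_neighborFinset_eq_degree]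
  rfl

open Classical in
lemma degR_eq_sum {V : Type*} [Fintype V] (G : SimpleGraph V) {n : ℕ} (φ : Fin n ≃ V)
    (i : Fin n) : degR G (φ i) = ∑ j, (decide (G.Adj (φ i) (φ j))).toNat := by
  rw [degR_eq_degree, ← G.card_neighborFinset_eq_degree, G.neighborFinset_eq_filter,
    Finset.card_filter, ← φ.sum_comp]
  exact Finset.sum_congr rfl fun j _ => by by_cases h : G.Adj (φ i) (φ j) <;> simp [h]

open Classical in
lemma sum_degR {V : Type*} [Fintype V] (G : SimpleGraph V) :
    ∑ v, degR G v = 2 * G.edgeSet.ncard := by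
  rw [Set.ncard_eq_toFinset_card']
  simp only [degR_eq_degree]
  exact G.sum_degrees_eq_twice_card_edges

open Classical in
/-- Summing `d(u) + d(v)` over the edges gives the first Zagreb index. -/
lemma sum_edges_degR_add {V : Type*} [Fintype V] (G : SimpleGraph V) :
    ∑ e ∈ G.edgeSet.toFinite.toFinset,
      Sym2.lift ⟨fun u v => degR G u + degR G v, fun _ _ => add_comm _ _⟩ e =
    ∑ v, degR G v ^ 2 := by
  have h1 : ∀ e ∈ G.edgeSet.toFinite.toFinset,
      Sym2.lift ⟨fun u v => degR G u + degR G v, fun _ _ => add_comm _ _⟩ e =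
      ∑ v, if v ∈ e then degR G v else 0 := by
    intro e he
    induction e with | _ u v
    have huv : u ≠ v := by
      rw [Set.Finite.mem_toFinset, mem_edgeSet] at he
      exact he.ne
    rw [Sym2.lift_mk, ← Finset.sum_filter,
      show Finset.univ.filter (fun w => w ∈ s(u, v)) = {u, v} by ext; simp,
      Finset.sum_pair huv]
  rw [Finset.sum_congr rfl h1, Finset.sum_comm]
  refine Finset.sum_congr rfl fun v _ => ?_
  rw [← Finset.sum_filter, Finset.sum_const, smul_eq_mul, sq]
  congr 1
  rw [degR_eq_degree, ← G.card_incidenceFinset_eq_degree]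
  congr 1
  ext e
  simp [incidenceSet]

/-- Lower bound for the sum-connectivity index in terms of the first Zagreb index. -/
lemma tangent_le_sumConn {V : Type*} [Fintype V] (G : SimpleGraph V) {r : ℝ} (hr : 0 < r) :
    (3 * G.edgeSet.ncard - (∑ v, degR G v ^ 2 : ℕ) / r ^ 2) / (2 * r) ≤ sumConn G := by
  rw [← sum_edges_degR_add, Set.ncard_eq_toFinset_card _ G.edgeSet.toFinite, sumConn]
  have : ∀ e ∈ G.edgeSet.toFinite.toFinset,
      (3 - ((Sym2.lift ⟨fun u v => degR G u + degR G v, fun _ _ => add_comm _ _⟩ e : ℕ) : ℝ)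
        / r ^ 2) / (2 * r) ≤
      Sym2.lift ⟨fun u v => (1 : ℝ) / Real.sqrt ((degR G u : ℝ) + (degR G v : ℝ)),
        fun u v => by simp [add_comm]⟩ e := by
    intro e he
    induction e with | _ u v
    simp only [Sym2.lift_mk]
    push_cast
    refine tangent_le_one_div_sqrt hr ?_
    have hadj : G.Adj u v := by simpa using he
    have : 0 < degR G u := (Set.ncard_pos (Set.toFinite _)).2 ⟨v, hadj⟩
    positivity
  refine le_trans (le_of_eq ?_) (Finset.sum_le_sum this)
  rw [← Finset.sum_div, Finset.sum_sub_distrib, ← Finset.sum_div]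
  simp [mul_comm]

/-- A graph on six vertices with matching number three has a perfect matching. -/
lemma exists_perfect_labelling {V : Type*} [Fintype V] (G : SimpleGraph V)
    (hcard : Fintype.card V = 6) (hmatch : matchingNumber G = 3) :
    ∃ φ : Fin 6 ≃ V, G.Adj (φ 0) (φ 1) ∧ G.Adj (φ 2) (φ 3) ∧ G.Adj (φ 4) (φ 5) := by
  obtain ⟨M, hM, hpair, hM3⟩ : 3 ∈ {k | ∃ M : Set (Sym2 V), M ⊆ G.edgeSet ∧
      M.Pairwise (fun e f => ∀ v, v ∈ e → v ∉ f) ∧ M.ncard = k} := by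
    rw [← hmatch]
    refine Nat.sSup_mem ⟨0, ∅, by simp⟩ ⟨G.edgeSet.ncard, ?_⟩
    rintro k ⟨M, hM, -, rfl⟩
    exact Set.ncard_le_ncard hM
  obtain ⟨x, y, z, hxy, hxz, hyz, rfl⟩ := Set.ncard_eq_three.1 hM3
  have h1 := hpair (by simp) (by simp) hxy
  have h2 := hpair (by simp) (by simp) hxz
  have h3 := hpair (by simp) (by simp) hyz
  induction x with | _ a b
  induction y with | _ c d
  induction z with | _ e f
  simp only [Set.insert_subset_iff, Set.singleton_subset_iff, mem_edgeSet] at hM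
  obtain ⟨hab, hcd, hef⟩ := hM
  simp only [Sym2.mem_iff, forall_eq_or_imp, forall_eq, not_or] at h1 h2 h3
  have hinj : Function.Injective ![a, b, c, d, e, f] := by
    have := hab.ne
    have := hcd.ne
    have := hef.ne
    intro i j hij
    fin_cases i <;> fin_cases j <;> simp at hij ⊢ <;> grind
  exact ⟨Equiv.ofBijective _ ((Fintype.bijective_iff_injective_and_card _).2
    ⟨hinj, by simp [hcard]⟩), hab, hcd, hef⟩

/-- In a perfect matching of six vertices any vertex can be labelled first. -/
lemma exists_perfect_labelling_zero {V : Type*} {G : SimpleGraph V} {φ : Fin 6 ≃ V}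
    (h : G.Adj (φ 0) (φ 1) ∧ G.Adj (φ 2) (φ 3) ∧ G.Adj (φ 4) (φ 5)) (v : V) :
    ∃ ψ : Fin 6 ≃ V, ψ 0 = v ∧
      G.Adj (ψ 0) (ψ 1) ∧ G.Adj (ψ 2) (ψ 3) ∧ G.Adj (ψ 4) (ψ 5) := by
  obtain ⟨i, rfl⟩ := φ.surjective v
  obtain ⟨h1, h2, h3⟩ := h
  have key : ∀ i : Fin 6, ∃ f : Fin 6 → Fin 6, Function.Injective f ∧ f 0 = i ∧
      (s(f 0, f 1) = s(0, 1) ∨ s(f 0, f 1) = s(2, 3) ∨ s(f 0, f 1) = s(4, 5)) ∧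
      (s(f 2, f 3) = s(0, 1) ∨ s(f 2, f 3) = s(2, 3) ∨ s(f 2, f 3) = s(4, 5)) ∧
      (s(f 4, f 5) = s(0, 1) ∨ s(f 4, f 5) = s(2, 3) ∨ s(f 4, f 5) = s(4, 5)) := by
    intro i
    fin_cases i
    · exact ⟨![0, 1, 2, 3, 4, 5], by decide⟩
    · exact ⟨![1, 0, 2, 3, 4, 5], by decide⟩
    · exact ⟨![2, 3, 0, 1, 4, 5], by decide⟩
    · exact ⟨![3, 2, 0, 1, 4, 5], by decide⟩
    · exact ⟨![4, 5, 2, 3, 0, 1], by decide⟩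
    · exact ⟨![5, 4, 2, 3, 0, 1], by decide⟩
  have adj : ∀ {a b : Fin 6}, s(a, b) = s(0, 1) ∨ s(a, b) = s(2, 3) ∨ s(a, b) = s(4, 5) →
      G.Adj (φ a) (φ b) := by
    simp only [Sym2.eq_iff]
    rintro a b ((⟨rfl, rfl⟩ | ⟨rfl, rfl⟩) | (⟨rfl, rfl⟩ | ⟨rfl, rfl⟩) | (⟨rfl, rfl⟩ | ⟨rfl, rfl⟩))
    exacts [h1, h1.symm, h2, h2.symm, h3, h3.symm]
  obtain ⟨f, hf, rfl, h01, h23, h45⟩ := key i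
  exact ⟨(Equiv.ofBijective f (Finite.injective_iff_bijective.1 hf)).trans φ, rfl,
    adj h01, adj h23, adj h45⟩

/-- The variables encode the twelve edges outside of the perfect matching `01, 23, 45`. -/
lemma sum_sq_degrees_le_forty : ∀ b02 b03 b04 b05 b12 b13 b14 b15 b24 b25 b34 b35 : Bool,
    b02.toNat + b03.toNat + b04.toNat + b05.toNat + b12.toNat + b13.toNat + b14.toNat
      + b15.toNat + b24.toNat + b25.toNat + b34.toNat + b35.toNat = 4 →
    1 + b02.toNat + b03.toNat + b04.toNat + b05.toNat ≤ 4 →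
    1 + b12.toNat + b13.toNat + b14.toNat + b15.toNat ≤ 4 →
    b02.toNat + b12.toNat + 1 + b24.toNat + b25.toNat ≤ 4 →
    b03.toNat + b13.toNat + 1 + b34.toNat + b35.toNat ≤ 4 →
    b04.toNat + b14.toNat + b24.toNat + b34.toNat + 1 ≤ 4 →
    b05.toNat + b15.toNat + b25.toNat + b35.toNat + 1 ≤ 4 →
    (1 + b02.toNat + b03.toNat + b04.toNat + b05.toNat) ^ 2
    + (1 + b12.toNat + b13.toNat + b14.toNat + b15.toNat) ^ 2
    + (b02.toNat + b12.toNat + 1 + b24.toNat + b25.toNat) ^ 2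
    + (b03.toNat + b13.toNat + 1 + b34.toNat + b35.toNat) ^ 2
    + (b04.toNat + b14.toNat + b24.toNat + b34.toNat + 1) ^ 2
    + (b05.toNat + b15.toNat + b25.toNat + b35.toNat + 1) ^ 2 ≤ 40 := by
  decide +kernel

open Classical in
lemma sum_sq_degR_le_forty {V : Type*} [Fintype V] {G : SimpleGraph V}
    (hedges : G.edgeSet.ncard = 7) {φ : Fin 6 ≃ V}
    (h : G.Adj (φ 0) (φ 1) ∧ G.Adj (φ 2) (φ 3) ∧ G.Adj (φ 4) (φ 5))
    (hdeg : ∀ v, degR G v ≤ 4) : ∑ v, degR G v ^ 2 ≤ 40 := by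
  obtain ⟨h1, h2, h3⟩ := h
  have hsum := sum_degR G
  rw [hedges, ← φ.sum_comp] at hsum
  rw [← φ.sum_comp]
  have d0 := hdeg (φ 0)
  have d1 := hdeg (φ 1)
  have d2 := hdeg (φ 2)
  have d3 := hdeg (φ 3)
  have d4 := hdeg (φ 4)
  have d5 := hdeg (φ 5)
  simp only [degR_eq_sum, Fin.sum_univ_six, G.irrefl, h1, h2, h3, h1.symm, h2.symm, h3.symm,
    decide_true, decide_false, Bool.toNat_true, Bool.toNat_false, zero_add, add_zero,
    G.adj_comm (φ 2) (φ 0), G.adj_comm (φ 2) (φ 1), G.adj_comm (φ 3) (φ 0),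
    G.adj_comm (φ 3) (φ 1), G.adj_comm (φ 4) (φ 0), G.adj_comm (φ 4) (φ 1),
    G.adj_comm (φ 4) (φ 2), G.adj_comm (φ 4) (φ 3), G.adj_comm (φ 5) (φ 0),
    G.adj_comm (φ 5) (φ 1), G.adj_comm (φ 5) (φ 2), G.adj_comm (φ 5) (φ 3)] at *
  exact sum_sq_degrees_le_forty _ _ _ _ _ _ _ _ _ _ _ _ (by omega) d0 d1 d2 d3 d4 d5

lemma extremal_value_lt : 4 / √7 + 1 / √6 + 1 < ((3 * 7 - 40 / 2.39 ^ 2) / (2 * 2.39) : ℝ) := by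
  have h7 : (2.6457 : ℝ) < √7 := Real.lt_sqrt_of_sq_lt (by norm_num)
  have h6 : (2.4494 : ℝ) < √6 := Real.lt_sqrt_of_sq_lt (by norm_num)
  have h7' : 4 / √7 < 4 / 2.6457 := by gcongr
  have h6' : 1 / √6 < 1 / 2.4494 := by gcongr
  have : (4 / 2.6457 + 1 / 2.4494 + 1 : ℝ) < (3 * 7 - 40 / 2.39 ^ 2) / (2 * 2.39) := by norm_num
  linarith

/-- The edges of two triangles and a pendent edge sharing the vertex `0`. -/
def bowtieEdges : Finset (Sym2 (Fin 6)) :=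
  {s(0, 1), s(0, 2), s(0, 3), s(0, 4), s(0, 5), s(2, 3), s(4, 5)}

lemma edges_eq_of_dominating {V : Type*} [Fintype V] {G : SimpleGraph V}
    (hedges : G.edgeSet.ncard = 7) {φ : Fin 6 ≃ V} (h23 : G.Adj (φ 2) (φ 3))
    (h45 : G.Adj (φ 4) (φ 5)) (hdom : ∀ w, w ≠ φ 0 → G.Adj (φ 0) w) :
    G.edgeSet.toFinite.toFinset = bowtieEdges.map φ.toEmbedding.sym2Map := by
  symm
  apply Finset.eq_of_subset_of_card_le
  · have h : ∀ i, i ≠ 0 → G.Adj (φ 0) (φ i) := fun i hi => hdom _ (by simpa using hi)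
    intro e
    simp only [bowtieEdges, Finset.mem_map, Finset.mem_insert, Finset.mem_singleton]
    rintro ⟨e, (rfl | rfl | rfl | rfl | rfl | rfl | rfl), rfl⟩ <;> simp [h, h23, h45]
  · rw [← Set.ncard_eq_toFinset_card, hedges, Finset.card_map]
    decide

lemma adj_iff_of_edges_eq {V : Type*} [Fintype V] {G : SimpleGraph V} {φ : Fin 6 ≃ V}
    (h : G.edgeSet.toFinite.toFinset = bowtieEdges.map φ.toEmbedding.sym2Map)
    (i j : Fin 6) : G.Adj (φ i) (φ j) ↔ s(i, j) ∈ bowtieEdges := by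
  have h1 : G.Adj (φ i) (φ j) ↔ φ.toEmbedding.sym2Map s(i, j) ∈ G.edgeSet.toFinite.toFinset := by simp
  rw [h1, h]
  exact Finset.mem_map' _

lemma sumConn_of_edges_eq {V : Type*} [Fintype V] {G : SimpleGraph V} {φ : Fin 6 ≃ V}
    (h : G.edgeSet.toFinite.toFinset = bowtieEdges.map φ.toEmbedding.sym2Map) :
    sumConn G = 4 / √7 + 1 / √6 + 1 := by
  have hdeg : ∀ i, degR G (φ i) = ∑ j, (decide (s(i, j) ∈ bowtieEdges)).toNat := by
    intro i
    simp only [degR_eq_sum, adj_iff_of_edges_eq h]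
  have d0 : degR G (φ 0) = 5 := (hdeg 0).trans (by decide)
  have d1 : degR G (φ 1) = 1 := (hdeg 1).trans (by decide)
  have d2 : degR G (φ 2) = 2 := (hdeg 2).trans (by decide)
  have d3 : degR G (φ 3) = 2 := (hdeg 3).trans (by decide)
  have d4 : degR G (φ 4) = 2 := (hdeg 4).trans (by decide)
  have d5 : degR G (φ 5) = 2 := (hdeg 5).trans (by decide)
  have h4 : √4 = 2 := by
    rw [show (4 : ℝ) = 2 ^ 2 by norm_num, Real.sqrt_sq (by norm_num)]
  rw [sumConn, h, Finset.sum_map, bowtieEdges]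
  repeat rw [Finset.sum_insert (by decide)]
  rw [Finset.sum_singleton]
  simp only [Equiv.coe_toEmbedding, Function.Embedding.sym2Map_apply, Sym2.map_mk, Sym2.lift_mk, d0, d1, d2,
    d3, d4, d5]
  norm_num [h4]
  ring

/-- The labelling of the vertices of `BnmGraph 6 3` matching `bowtieEdges`. -/
def bowtieLabel : BnmVert 6 3 → Fin 6
  | Sum.inl _ => 0
  | Sum.inr (Sum.inl i) => i.natAdd 2
  | Sum.inr (Sum.inr _) => 1

lemma bowtieLabel_bijective : Function.Bijective bowtieLabel := by
  refine (Fintype.bijective_iff_surjective_and_card _).2 ⟨fun i => ?_, rfl⟩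
  fin_cases i
  exacts [⟨Sum.inl (), rfl⟩, ⟨Sum.inr (Sum.inr (Sum.inl 0)), rfl⟩, ⟨Sum.inr (Sum.inl 0), rfl⟩,
    ⟨Sum.inr (Sum.inl 1), rfl⟩, ⟨Sum.inr (Sum.inl 2), rfl⟩, ⟨Sum.inr (Sum.inl 3), rfl⟩]

lemma bnmGraph_adj_iff (x y : BnmVert 6 3) :
    (BnmGraph 6 3).Adj x y ↔ s(bowtieLabel x, bowtieLabel y) ∈ bowtieEdges := by
  rw [BnmGraph, fromRel_adj, ← bowtieLabel_bijective.injective.ne_iff]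
  rcases x with ⟨⟩ | i | i | ⟨i, -⟩ <;> rcases y with ⟨⟩ | j | j | ⟨j, -⟩ <;>
    first
    | exact i.elim0
    | exact j.elim0
    | (simp only [BnmRel, bowtieLabel]
       first
       | decide
       | (revert i j; decide)
       | (revert i; decide)
       | (revert j; decide))

lemma iso_of_edges_eq {V : Type*} [Fintype V] {G : SimpleGraph V} {φ : Fin 6 ≃ V}
    (h : G.edgeSet.toFinite.toFinset = bowtieEdges.map φ.toEmbedding.sym2Map) :
    Nonempty (G ≃g BnmGraph 6 3) :=
  ⟨Iso.symm ⟨(Equiv.ofBijective _ bowtieLabel_bijective).trans φ, fun {x y} =>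
    (adj_iff_of_edges_eq h _ _).trans (bnmGraph_adj_iff x y).symm⟩⟩

lemma exists_dominating_of_iso {V : Type*} {G : SimpleGraph V} (ι : G ≃g BnmGraph 6 3) :
    ∃ v, ∀ w, w ≠ v → G.Adj v w := by
  obtain ⟨c, hc⟩ := bowtieLabel_bijective.surjective 0
  refine ⟨ι.symm c, fun w hw => ?_⟩
  obtain ⟨x, rfl⟩ := ι.symm.surjective w
  rw [ι.symm.map_adj_iff, bnmGraph_adj_iff, hc]
  have hx : bowtieLabel x ≠ 0 := fun h0 =>
    hw (congrArg _ (bowtieLabel_bijective.injective (h0.trans hc.symm)))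
  generalize bowtieLabel x = i at hx
  revert i
  decide

lemma degR_le_of_not_dominating {V : Type*} [Fintype V] {G : SimpleGraph V}
    (hcard : Fintype.card V = 6) {v : V} (h : ¬ ∀ w, w ≠ v → G.Adj v w) : degR G v ≤ 4 := by
  classical
  push Not at h
  obtain ⟨w, hw, hvw⟩ := h
  have hsub : G.neighborFinset v ⊆ {v, w}ᶜ := by
    intro u hu
    rw [mem_neighborFinset] at hu
    simp only [Finset.mem_compl, Finset.mem_insert, Finset.mem_singleton, not_or]
    exact ⟨hu.ne', fun h => hvw (h ▸ hu)⟩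
  rw [degR_eq_degree, ← G.card_neighborFinset_eq_degree]
  refine (Finset.card_le_card hsub).trans ?_
  rw [Finset.card_compl, hcard, Finset.card_pair hw.symm]

/-- Let `G` be a bicyclic graph with `6` vertices and matching number `3`. Then
`χ(G) ≥ 4/√7 + 1/√6 + 1`, with equality if and only if `G ≅ B_{6,3}`. -/
theorem stmt_4 {V : Type*} [Fintype V] (G : SimpleGraph V)
    (hcard : Fintype.card V = 6) (hconn : G.Connected)
    (hedges : G.edgeSet.ncard = 7)
    (hmatch : matchingNumber G = 3) :
    sumConn G ≥ 4 / Real.sqrt 7 + 1 / Real.sqrt 6 + 1 ∧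
    (sumConn G = 4 / Real.sqrt 7 + 1 / Real.sqrt 6 + 1 ↔
      Nonempty (G ≃g BnmGraph 6 3)) := by
  obtain ⟨φ, hφ⟩ := exists_perfect_labelling G hcard hmatch
  by_cases hdom : ∃ v, ∀ w, w ≠ v → G.Adj v w
  · obtain ⟨v, hv⟩ := hdom
    obtain ⟨ψ, rfl, -, h23, h45⟩ := exists_perfect_labelling_zero hφ v
    have hE := edges_eq_of_dominating hedges h23 h45 hv
    have hval := sumConn_of_edges_eq hE
    exact ⟨hval.ge, fun _ => iso_of_edges_eq hE, fun _ => hval⟩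
  · have hsq := sum_sq_degR_le_forty hedges hφ fun v =>
      degR_le_of_not_dominating hcard fun hv => hdom ⟨v, hv⟩
    have hsq' : ((∑ v, degR G v ^ 2 : ℕ) : ℝ) ≤ 40 := mod_cast hsq
    have hlt : 4 / √7 + 1 / √6 + 1 < sumConn G := by
      refine extremal_value_lt.trans_le (le_trans ?_ (tangent_le_sumConn G (r := 2.39) (by norm_num)))
      rw [hedges]
      push_cast at hsq' ⊢
      gcongr
    exact ⟨hlt.le, fun h => absurd h hlt.ne', fun ⟨ι⟩ => absurd (exists_dominating_of_iso ι) hdom⟩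
end

section
/- Let G be a bicyclic graph with 2m vertices and matching number m (i.e., G has a perfect matching), where m ≥ 3. Then χ(G) ≥ (m+1)/√(m+4) + 1/√(m+3) + (m−3)/√3 + 1, with equality if and only if G is isomorphic to B_{2m,m}. -/
open SimpleGraph

/-- The weight `1/√n` of an edge whose end degrees add up to `n`. -/
noncomputable def edgeWeight (n : ℕ) : ℝ := 1 / √(n : ℝ)

lemma edgeWeight_lt {n : ℕ} {q : ℝ} (hq : 0 < q) (h : 1 < q ^ 2 * n) : edgeWeight n < q := by
  unfold edgeWeight
  have hn : (0 : ℝ) < n := by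
    by_contra hn
    nlinarith [sq_nonneg q]
  rw [div_lt_iff₀ (Real.sqrt_pos.2 hn), ← div_lt_iff₀' hq]
  apply Real.lt_sqrt_of_sq_lt
  rw [div_pow, div_lt_iff₀ (by positivity)]
  linarith

lemma edgeWeight_le {n : ℕ} {q : ℝ} (hq : 0 < q) (h : 1 ≤ q ^ 2 * n) : edgeWeight n ≤ q := by
  unfold edgeWeight
  have hn : (0 : ℝ) < n := by
    by_contra hn
    nlinarith [sq_nonneg q]
  rw [div_le_iff₀ (Real.sqrt_pos.2 hn), ← div_le_iff₀' hq]
  apply Real.le_sqrt_of_sq_le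
  rw [div_pow, div_le_iff₀ (by positivity)]
  linarith

lemma lt_edgeWeight {n : ℕ} {q : ℝ} (hn : 0 < n) (hq : 0 < q) (h : q ^ 2 * n < 1) :
    q < edgeWeight n := by
  unfold edgeWeight
  have hn : (0 : ℝ) < n := by exact_mod_cast hn
  rw [lt_div_iff₀ (Real.sqrt_pos.2 hn), ← lt_div_iff₀' hq, Real.sqrt_lt' (by positivity),
    div_pow, lt_div_iff₀ (by positivity)]
  linarith

lemma edgeWeight_pos {n : ℕ} (hn : 0 < n) : 0 < edgeWeight n := by
  unfold edgeWeight
  have hn : (0 : ℝ) < n := by exact_mod_cast hn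
  positivity

lemma edgeWeight_four : edgeWeight 4 = 1 / 2 := by
  unfold edgeWeight
  rw [show ((4 : ℕ) : ℝ) = 2 ^ 2 by norm_num, Real.sqrt_sq (by norm_num)]

lemma edgeWeight_anti {a b : ℕ} (ha : 0 < a) (hab : a ≤ b) : edgeWeight b ≤ edgeWeight a := by
  unfold edgeWeight
  have ha : (0 : ℝ) < a := by exact_mod_cast ha
  gcongr

lemma edgeWeight_sub_succ {a : ℕ} (ha : 0 < a) :
    edgeWeight a - edgeWeight (a + 1) =
      1 / (√(a : ℝ) * √((a + 1 : ℕ) : ℝ) * (√(a : ℝ) + √((a + 1 : ℕ) : ℝ))) := by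
  unfold edgeWeight
  have h1 : (0 : ℝ) < a := by exact_mod_cast ha
  have h2 : (0 : ℝ) < ((a + 1 : ℕ) : ℝ) := by positivity
  have h3 := Real.sqrt_pos.2 h1
  have h4 := Real.sqrt_pos.2 h2
  have h5 := Real.sq_sqrt h1.le
  have h6 := Real.sq_sqrt h2.le
  field_simp
  push_cast at h6 ⊢
  nlinarith

lemma edgeWeight_sub_succ_anti {a b : ℕ} (ha : 0 < a) (hab : a ≤ b) :
    edgeWeight b - edgeWeight (b + 1) ≤ edgeWeight a - edgeWeight (a + 1) := by
  rw [edgeWeight_sub_succ ha, edgeWeight_sub_succ (ha.trans_le hab)]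
  have ha : (0 : ℝ) < a := by exact_mod_cast ha
  have : (0 : ℝ) < ((a + 1 : ℕ) : ℝ) := by positivity
  gcongr

/-- `1/√n` lies above each of its integer chords, extended to all integers. -/
lemma chord_le_edgeWeight {a n : ℕ} (ha : 0 < a) (hn : 0 < n) :
    edgeWeight a - ((n : ℝ) - a) * (edgeWeight a - edgeWeight (a + 1)) ≤ edgeWeight n := by
  rcases le_total a n with h | h
  · induction n, h using Nat.le_induction with
    | base => simp
    | succ n h ih =>
      have := ih (ha.trans_le h)
      have := edgeWeight_sub_succ_anti ha h
      push_cast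
      linarith
  · obtain ⟨k, rfl⟩ := Nat.exists_eq_add_of_le h
    clear h
    induction k generalizing n with
    | zero => simp
    | succ k ih =>
      have h1 := ih (n := n + 1) (by omega) (by omega)
      have h2 := edgeWeight_sub_succ_anti hn (show n ≤ n + 1 + k by omega)
      rw [show n + (k + 1) = n + 1 + k by ring]
      push_cast at h1 ⊢
      linarith

/-- A lower bound, up to the constant `1/√3`, for what a pendent path of length two attached to a
vertex of degree `d` contributes to the sum-connectivity index. -/
noncomputable def pathGain (d : ℕ) : ℝ :=
  ((d : ℝ) - 1) * edgeWeight (d + 2) - ((d : ℝ) - 3) * edgeWeight (d + 1) - edgeWeight d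

lemma edgeWeight_le_mul {n t : ℕ} {r : ℝ} (ht : 0 < t) (hr : 0 < r) (h : (t : ℝ) ≤ r ^ 2 * n) :
    edgeWeight n ≤ r * edgeWeight t := by
  have ht' : (0 : ℝ) < t := by exact_mod_cast ht
  have hw := edgeWeight_pos ht
  apply edgeWeight_le (by positivity)
  have : edgeWeight t ^ 2 = 1 / t := by
    rw [edgeWeight, div_pow, Real.sq_sqrt ht'.le, one_pow]
  rw [mul_pow, this]
  field_simp
  exact h

lemma pathGain_succ_lt {d : ℕ} (hd : 2 ≤ d) : pathGain (d + 1) < pathGain d := by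
  suffices h : d * edgeWeight (d + 3) + ((d : ℝ) - 4) * edgeWeight (d + 1) + edgeWeight d <
      (2 * d - 3) * edgeWeight (d + 2) by
    unfold pathGain
    push_cast
    linarith
  rcases lt_or_ge d 5 with h5 | h5
  · have h3 : edgeWeight 3 < 0.57736 := edgeWeight_lt (by norm_num) (by norm_num)
    have h3' : 0.57735 < edgeWeight 3 := lt_edgeWeight (by norm_num) (by norm_num) (by norm_num)
    have h2 : edgeWeight 2 < 0.7072 := edgeWeight_lt (by norm_num) (by norm_num)
    have h5 : edgeWeight 5 < 0.44722 := edgeWeight_lt (by norm_num) (by norm_num)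
    have h5' : 0.44721 < edgeWeight 5 := lt_edgeWeight (by norm_num) (by norm_num) (by norm_num)
    have h6 : edgeWeight 6 < 0.40825 := edgeWeight_lt (by norm_num) (by norm_num)
    have h6' : 0.40824 < edgeWeight 6 := lt_edgeWeight (by norm_num) (by norm_num) (by norm_num)
    have h7 : edgeWeight 7 < 0.37797 := edgeWeight_lt (by norm_num) (by norm_num)
    have h4 := edgeWeight_four
    interval_cases d <;> norm_num at * <;> linarith
  · obtain ⟨k, rfl⟩ := Nat.exists_eq_add_of_le h5
    set x : ℝ := 1 / ((k : ℝ) + 7) with hx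
    have hk : (0 : ℝ) ≤ k := by positivity
    have hx0 : 0 < x := by positivity
    have hx1 : x ≤ 1 / 7 := by
      rw [hx]; apply one_div_le_one_div_of_le <;> linarith
    have hkx : (k : ℝ) = 1 / x - 7 := by rw [hx]; field_simp; ring
    have e1 : edgeWeight (5 + k + 3) ≤
        (1 - x / 2 + 3 * x ^ 2 / 8) * edgeWeight (5 + k + 2) := by
      apply edgeWeight_le_mul (by omega) (by nlinarith)
      push_cast
      rw [hkx]
      field_simp
      ring_nf
      nlinarith [mul_pos hx0 hx0, mul_pos hx0 (mul_pos hx0 hx0), pow_pos hx0 4, pow_pos hx0 5]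
    have e2 : edgeWeight (5 + k + 1) ≤
        (1 + x / 2 + 3 * x ^ 2 / 8 + x ^ 3 / 2) * edgeWeight (5 + k + 2) := by
      apply edgeWeight_le_mul (by omega) (by positivity)
      push_cast
      rw [hkx]
      field_simp
      ring_nf
      nlinarith [mul_pos hx0 hx0, mul_pos hx0 (mul_pos hx0 hx0), pow_pos hx0 4, pow_pos hx0 5,
        pow_pos hx0 6, pow_pos hx0 7, mul_le_mul_of_nonneg_left hx1 (pow_pos hx0 3).le,
        mul_le_mul_of_nonneg_left hx1 (pow_pos hx0 4).le,
        mul_le_mul_of_nonneg_left hx1 (pow_pos hx0 5).le,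
        mul_le_mul_of_nonneg_left hx1 (pow_pos hx0 6).le]
    have e3 : edgeWeight (5 + k) ≤ (1 + x + 2 * x ^ 2) * edgeWeight (5 + k + 2) := by
      apply edgeWeight_le_mul (by omega) (by positivity)
      push_cast
      rw [hkx]
      field_simp
      ring_nf
      nlinarith [mul_pos hx0 hx0, mul_pos hx0 (mul_pos hx0 hx0), pow_pos hx0 4, pow_pos hx0 5,
        mul_le_mul_of_nonneg_left hx1 (pow_pos hx0 2).le,
        mul_le_mul_of_nonneg_left hx1 (pow_pos hx0 3).le,
        mul_le_mul_of_nonneg_left hx1 (pow_pos hx0 4).le]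
    have hw := edgeWeight_pos (show 0 < 5 + k + 2 by omega)
    push_cast
    have key : (5 + (k : ℝ)) * (1 - x / 2 + 3 * x ^ 2 / 8) +
        (5 + k - 4) * (1 + x / 2 + 3 * x ^ 2 / 8 + x ^ 3 / 2) + (1 + x + 2 * x ^ 2) <
        2 * (5 + k) - 3 := by
      rw [hkx, ← sub_neg]
      field_simp
      ring_nf
      nlinarith [mul_pos hx0 hx0, pow_pos hx0 3, pow_pos hx0 4]
    nlinarith [mul_le_mul_of_nonneg_left e1 (show (0 : ℝ) ≤ 5 + k by linarith),
      mul_le_mul_of_nonneg_left e2 (show (0 : ℝ) ≤ 5 + k - 4 by linarith),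
      mul_lt_mul_of_pos_right key hw]

lemma pathGain_lt {d e : ℕ} (hd : 2 ≤ d) (hde : d < e) : pathGain e < pathGain d := by
  induction e, hde using Nat.le_induction with
  | base => exact pathGain_succ_lt hd
  | succ e he ih => exact (pathGain_succ_lt (by omega)).trans ih

/-- The claimed minimum of the sum-connectivity index. -/
noncomputable def chiMin (m : ℕ) : ℝ :=
  (m + 1) * edgeWeight (m + 4) + edgeWeight (m + 3) + (m - 3) * edgeWeight 3 + 1

lemma chiMin_succ (m : ℕ) : chiMin (m + 1) = chiMin m + (edgeWeight 3 + pathGain (m + 3)) := by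
  unfold chiMin pathGain
  push_cast
  rw [show m + 1 + 4 = m + 3 + 2 by ring, show m + 1 + 3 = m + 3 + 1 by ring]
  ring

lemma chiMin_le_linear {m : ℕ} (hm : 4 ≤ m) : chiMin m < 3.7232 + 0.825 * ((m : ℝ) - 4) := by
  induction m, hm using Nat.le_induction with
  | base =>
    unfold chiMin
    have h3 : edgeWeight 3 < 0.57736 := edgeWeight_lt (by norm_num) (by norm_num)
    have h7 : edgeWeight 7 < 0.37797 := edgeWeight_lt (by norm_num) (by norm_num)
    have h8 : edgeWeight 8 < 0.35356 := edgeWeight_lt (by norm_num) (by norm_num)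
    norm_num at *
    linarith
  | succ m hm ih =>
    rw [chiMin_succ]
    have h : pathGain (m + 3) < pathGain 6 := pathGain_lt (by norm_num) (by omega)
    have h3 : edgeWeight 3 < 0.57736 := edgeWeight_lt (by norm_num) (by norm_num)
    have h7 : 0.37796 < edgeWeight 7 := lt_edgeWeight (by norm_num) (by norm_num) (by norm_num)
    have h6 : 0.40824 < edgeWeight 6 := lt_edgeWeight (by norm_num) (by norm_num) (by norm_num)
    have h8 : edgeWeight 8 < 0.35356 := edgeWeight_lt (by norm_num) (by norm_num)
    have : pathGain 6 = 5 * edgeWeight 8 - 3 * edgeWeight 7 - edgeWeight 6 := by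
      unfold pathGain
      norm_num
    push_cast
    linarith

section MatchedBicyclic

open Finset

variable {V : Type*} [DecidableEq V] {G : SimpleGraph V} [DecidableRel G.Adj]

/-- The neighbours of `x` inside `S`. -/
def nbrsIn (G : SimpleGraph V) [DecidableRel G.Adj] (S : Finset V) (x : V) : Finset V :=
  {y ∈ S | G.Adj x y}

/-- The degree of `x` in the subgraph induced by `S`. -/
def degIn (G : SimpleGraph V) [DecidableRel G.Adj] (S : Finset V) (x : V) : ℕ :=
  #(nbrsIn G S x)

/-- Twice the sum-connectivity index of the subgraph induced by `S`. -/
noncomputable def doubleChi (G : SimpleGraph V) [DecidableRel G.Adj] (S : Finset V) : ℝ :=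
  ∑ x ∈ S, ∑ y ∈ nbrsIn G S x, edgeWeight (degIn G S x + degIn G S y)

/-- The subgraph of `G` induced by `S` is connected and bicyclic, has `2 * m` vertices, and `τ`
exchanges the ends of the edges of a perfect matching of it. -/
structure MatchedBicyclic (G : SimpleGraph V) [DecidableRel G.Adj] (τ : V → V) (S : Finset V)
    (m : ℕ) : Prop where
  card : #S = 2 * m
  sum_deg : ∑ x ∈ S, degIn G S x = 4 * m + 2
  mate_mem : ∀ x ∈ S, τ x ∈ S
  adj_mate : ∀ x ∈ S, G.Adj x (τ x)
  mate_mate : ∀ x ∈ S, τ (τ x) = x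
  exists_adj : ∀ A ⊆ S, A.Nonempty → A ≠ S → ∃ a ∈ A, ∃ b ∈ S \ A, G.Adj a b

omit [DecidableEq V] in
lemma mem_nbrsIn {S : Finset V} {x y : V} : y ∈ nbrsIn G S x ↔ y ∈ S ∧ G.Adj x y := by
  simp [nbrsIn]

omit [DecidableEq V] in
lemma sum_nbrsIn_comm (S : Finset V) (F : V → V → ℝ) :
    ∑ x ∈ S, ∑ y ∈ nbrsIn G S x, F x y = ∑ x ∈ S, ∑ y ∈ nbrsIn G S x, F y x := by
  apply Finset.sum_comm'
  intro x y
  simp only [mem_nbrsIn, G.adj_comm x y]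
  tauto

namespace MatchedBicyclic

variable {τ : V → V} {S : Finset V} {m : ℕ}

lemma mate_mem_nbrsIn (H : MatchedBicyclic G τ S m) {x : V} (hx : x ∈ S) :
    τ x ∈ nbrsIn G S x :=
  mem_nbrsIn.2 ⟨H.mate_mem x hx, H.adj_mate x hx⟩

lemma degIn_pos (H : MatchedBicyclic G τ S m) {x : V} (hx : x ∈ S) : 0 < degIn G S x :=
  card_pos.2 ⟨_, H.mate_mem_nbrsIn hx⟩

lemma card_erase_mate (H : MatchedBicyclic G τ S m) {x : V} (hx : x ∈ S) :
    #((nbrsIn G S x).erase (τ x)) + 1 = degIn G S x :=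
  card_erase_add_one (H.mate_mem_nbrsIn hx)

lemma mate_eq_iff (H : MatchedBicyclic G τ S m) {x y : V} (hx : x ∈ S) (hy : y ∈ S) :
    τ x = y ↔ x = τ y := by
  constructor
  · rintro rfl
    exact (H.mate_mate x hx).symm
  · rintro rfl
    exact H.mate_mate y hy

lemma two_le_degIn (H : MatchedBicyclic G τ S m) {x y : V} (hx : x ∈ S) (hy : y ∈ S)
    (hxy : G.Adj x y) (hne : y ≠ τ x) : 2 ≤ degIn G S y := by
  have h : ({x, τ y} : Finset V) ⊆ nbrsIn G S y := by
    intro z hz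
    rw [mem_insert, mem_singleton] at hz
    rcases hz with rfl | rfl
    · exact mem_nbrsIn.2 ⟨hx, hxy.symm⟩
    · exact H.mate_mem_nbrsIn hy
  have := card_le_card h
  rwa [card_pair] at this
  rw [Ne, ← H.mate_eq_iff hx hy]
  exact hne.symm

lemma sum_mate {M : Type*} [AddCommMonoid M] (H : MatchedBicyclic G τ S m) (f : V → M) :
    ∑ x ∈ S, f (τ x) = ∑ x ∈ S, f x :=
  sum_nbij' τ τ H.mate_mem H.mate_mem H.mate_mate H.mate_mate fun _ _ => rfl

lemma sum_nbrsIn_split (H : MatchedBicyclic G τ S m) (F : V → V → ℝ) :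
    ∑ x ∈ S, ∑ y ∈ nbrsIn G S x, F x y =
      ∑ x ∈ S, F x (τ x) + ∑ x ∈ S, ∑ y ∈ (nbrsIn G S x).erase (τ x), F x y := by
  rw [← sum_add_distrib]
  exact sum_congr rfl fun x hx => (add_sum_erase _ _ (H.mate_mem_nbrsIn hx)).symm

lemma sum_pairDeg (H : MatchedBicyclic G τ S m) :
    ∑ x ∈ S, (degIn G S x + degIn G S (τ x)) = 8 * m + 4 := by
  rw [sum_add_distrib, H.sum_mate (degIn G S), H.sum_deg]
  ring

lemma sum_erase_const (H : MatchedBicyclic G τ S m) (r : ℝ) :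
    ∑ x ∈ S, ∑ _y ∈ (nbrsIn G S x).erase (τ x), r = (2 * m + 2) * r := by
  have h : ∑ x ∈ S, (#((nbrsIn G S x).erase (τ x)) + 1) = 4 * m + 2 := by
    rw [← H.sum_deg]
    exact sum_congr rfl fun x hx => H.card_erase_mate hx
  rw [sum_add_distrib, sum_const, H.card] at h
  simp only [sum_const, nsmul_eq_mul, ← sum_mul]
  congr 1
  have : ∑ x ∈ S, #((nbrsIn G S x).erase (τ x)) = 2 * m + 2 := by
    simp at h
    omega
  exact_mod_cast this

/-- The edges avoiding two adjacent vertices include the matching edges avoiding them. -/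
lemma degIn_add_le_aux (H : MatchedBicyclic G τ S m) {u v : V} (hu : u ∈ S) (hv : v ∈ S)
    (huv : G.Adj u v) :
    2 * (degIn G S u + degIn G S v) + #(S \ {u, v, τ u, τ v}) ≤ 4 * m + 4 := by
  have h1 : ∑ x ∈ S, #({u, v} ∩ nbrsIn G S x) = degIn G S u + degIn G S v := by
    have : ∀ x ∈ S, #({u, v} ∩ nbrsIn G S x) =
        (if x ∈ nbrsIn G S u then 1 else 0) + (if x ∈ nbrsIn G S v then 1 else 0) := by
      intro x hx
      have e : ({u, v} : Finset V) ∩ nbrsIn G S x = ({u, v} : Finset V).filter (G.Adj x) := by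
        ext z
        simp only [mem_inter, mem_insert, mem_singleton, mem_nbrsIn, mem_filter]
        constructor
        · tauto
        · rintro ⟨rfl | rfl, h⟩ <;> tauto
      rw [e, card_filter, sum_pair huv.ne]
      simp only [mem_nbrsIn, hx, true_and, G.adj_comm x]
    rw [sum_congr rfl this, sum_add_distrib, ← card_filter, ← card_filter]
    have e : ∀ z, S.filter (· ∈ nbrsIn G S z) = nbrsIn G S z := by
      intro z
      ext x
      simp only [mem_filter, mem_nbrsIn]
      tauto
    rw [e, e]
    rfl
  have h2 : ∑ x ∈ S, #(nbrsIn G S x \ {u, v}) + (degIn G S u + degIn G S v) = 4 * m + 2 := by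
    rw [← H.sum_deg, ← h1, ← sum_add_distrib]
    refine sum_congr rfl fun x _ => ?_
    rw [inter_comm, degIn, card_sdiff_add_card_inter]
  have hsub : ({u, v} : Finset V) ⊆ S := by
    intro z hz
    rw [mem_insert, mem_singleton] at hz
    rcases hz with rfl | rfl <;> assumption
  rw [← sum_sdiff hsub, sum_pair huv.ne] at h2
  have h3 : ∀ a b, G.Adj a b → degIn G S a ≤ #(nbrsIn G S a \ {a, b}) + 1 := by
    intro a b _
    have : nbrsIn G S a ⊆ insert b (nbrsIn G S a \ {a, b}) := by
      intro z hz
      have := (mem_nbrsIn.1 hz).2.ne'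
      simp only [mem_insert, mem_sdiff, mem_singleton]
      tauto
    exact (card_le_card this).trans (card_insert_le _ _)
  have hu' := h3 u v huv
  have hv' := h3 v u huv.symm
  rw [pair_comm v u] at hv'
  have h4 : #(S \ {u, v, τ u, τ v}) ≤ ∑ x ∈ S \ {u, v}, #(nbrsIn G S x \ {u, v}) := by
    rw [card_eq_sum_ones]
    calc ∑ x ∈ S \ {u, v, τ u, τ v}, 1 ≤ ∑ x ∈ S \ {u, v, τ u, τ v}, #(nbrsIn G S x \ {u, v}) := by
          refine sum_le_sum fun x hx => ?_
          simp only [mem_sdiff, mem_insert, mem_singleton, not_or] at hx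
          refine card_pos.2 ⟨τ x, mem_sdiff.2 ⟨H.mate_mem_nbrsIn hx.1, ?_⟩⟩
          simp only [mem_insert, mem_singleton, H.mate_eq_iff hx.1 hu, H.mate_eq_iff hx.1 hv]
          tauto
      _ ≤ _ := by
          refine sum_le_sum_of_subset fun x hx => ?_
          simp only [mem_sdiff, mem_insert, mem_singleton, not_or] at hx ⊢
          tauto
  omega

lemma degIn_add_le (H : MatchedBicyclic G τ S m) {u v : V} (hu : u ∈ S) (hv : v ∈ S)
    (huv : G.Adj u v) : degIn G S u + degIn G S v ≤ m + 4 := by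
  have h := H.degIn_add_le_aux hu hv huv
  have h1 := le_card_sdiff {u, v, τ u, τ v} S
  have h2 : #{u, v, τ u, τ v} ≤ 4 := card_le_four
  rw [H.card] at h1
  omega

lemma pairDeg_le (H : MatchedBicyclic G τ S m) {u : V} (hu : u ∈ S) :
    degIn G S u + degIn G S (τ u) ≤ m + 3 := by
  have h := H.degIn_add_le_aux hu (H.mate_mem u hu) (H.adj_mate u hu)
  rw [H.mate_mate u hu] at h
  have h1 := le_card_sdiff {u, τ u, τ u, u} S
  have h2 : #{u, τ u, τ u, u} ≤ 2 := by
    rw [show ({u, τ u, τ u, u} : Finset V) = {u, τ u} by ext; simp; tauto]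
    exact card_le_two
  rw [H.card] at h1
  omega

lemma degIn_le (H : MatchedBicyclic G τ S m) {u : V} (hu : u ∈ S) : degIn G S u ≤ m + 2 := by
  have := H.pairDeg_le hu
  have := H.degIn_pos (H.mate_mem u hu)
  omega

lemma three_le_pairDeg (H : MatchedBicyclic G τ S m) (hm : 2 ≤ m) {u : V} (hu : u ∈ S) :
    3 ≤ degIn G S u + degIn G S (τ u) := by
  have hv := H.mate_mem u hu
  have h1 := H.degIn_pos hu
  have h2 := H.degIn_pos hv
  obtain ⟨a, ha, b, hb, hab⟩ := H.exists_adj {u, τ u}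
    (by intro z hz; rw [mem_insert, mem_singleton] at hz; rcases hz with rfl | rfl <;> assumption)
    (by simp)
    (by
      intro h
      have := H.card
      rw [← h] at this
      have h3 : #{u, τ u} ≤ 2 := card_le_two
      omega)
  simp only [mem_sdiff, mem_insert, mem_singleton, not_or] at ha hb
  rcases ha with rfl | rfl
  · have := H.two_le_degIn hb.1 hu hab.symm
      (fun h => hb.2.2 ((H.mate_eq_iff hb.1 hu).1 h.symm))
    omega
  · have := H.two_le_degIn hb.1 hv hab.symm
      (fun h => hb.2.1 (by rw [← H.mate_mate b hb.1, ← h, H.mate_mate u hu]))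
    omega

lemma doubleChi_eq (H : MatchedBicyclic G τ S m) :
    doubleChi G S = ∑ x ∈ S, edgeWeight (degIn G S x + degIn G S (τ x)) +
      ∑ x ∈ S, ∑ y ∈ (nbrsIn G S x).erase (τ x), edgeWeight (degIn G S x + degIn G S y) :=
  H.sum_nbrsIn_split _

section MaxDegree

variable {c : V}

lemma degIn_mate_of_max (H : MatchedBicyclic G τ S m) (hc : c ∈ S) (hdeg : degIn G S c = m + 2) :
    degIn G S (τ c) = 1 := by
  have := H.pairDeg_le hc
  have := H.degIn_pos (H.mate_mem c hc)
  omega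

lemma degIn_nbr_of_max (H : MatchedBicyclic G τ S m) (hc : c ∈ S) (hdeg : degIn G S c = m + 2)
    {x : V} (hx : x ∈ S) (hcx : G.Adj c x) (hne : x ≠ τ c) : degIn G S x = 2 := by
  have := H.degIn_add_le hc hx hcx
  have := H.two_le_degIn hc hx hcx hne
  omega

lemma degIn_other_of_max (H : MatchedBicyclic G τ S m) (hc : c ∈ S) (hdeg : degIn G S c = m + 2)
    {x : V} (hx : x ∈ S) (hcx : ¬ G.Adj c x) (hne : x ≠ c) : degIn G S x = 1 := by
  have hT : #((nbrsIn G S c).erase (τ c)) = m + 1 := by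
    have := H.card_erase_mate hc
    omega
  have hcN : c ∉ nbrsIn G S c := by simp [mem_nbrsIn]
  have hsub : insert c (nbrsIn G S c) ⊆ S := by
    intro z hz
    rcases mem_insert.1 hz with rfl | hz
    · exact hc
    · exact (mem_nbrsIn.1 hz).1
  have htwo : ∑ z ∈ (nbrsIn G S c).erase (τ c), degIn G S z = (m + 1) * 2 := by
    rw [← hT, ← smul_eq_mul, ← sum_const]
    refine sum_congr rfl fun z hz => ?_
    have := mem_nbrsIn.1 (mem_of_mem_erase hz)
    exact H.degIn_nbr_of_max hc hdeg this.1 this.2 (ne_of_mem_erase hz)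
  have hsum := H.sum_deg
  rw [← sum_sdiff hsub, sum_insert hcN, hdeg, ← add_sum_erase _ _ (H.mate_mem_nbrsIn hc),
    H.degIn_mate_of_max hc hdeg, htwo] at hsum
  have hcard : #(S \ insert c (nbrsIn G S c)) + (m + 3) = 2 * m := by
    rw [← H.card, ← card_sdiff_add_card_eq_card hsub, card_insert_of_notMem hcN]
    unfold degIn at hdeg
    omega
  have hx' : x ∈ S \ insert c (nbrsIn G S c) := by
    simp [hx, hne, mem_nbrsIn, hcx]
  have h1 : ∑ z ∈ S \ insert c (nbrsIn G S c), 1 =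
      ∑ z ∈ S \ insert c (nbrsIn G S c), degIn G S z := by
    rw [sum_const, smul_eq_mul]
    omega
  exact ((sum_eq_sum_iff_of_le fun z hz => H.degIn_pos (mem_sdiff.1 hz).1).1 h1 x hx').symm

lemma eq_of_adj_of_max (H : MatchedBicyclic G τ S m) (hc : c ∈ S) (hdeg : degIn G S c = m + 2)
    {x y : V} (hx : x ∈ S) (hy : y ∈ S) (hxy : G.Adj x y) (hxc : x ≠ c) (hne : y ≠ τ x) :
    y = c := by
  have h2 : degIn G S x ≤ 2 := by
    by_cases hcx : G.Adj c x
    · by_cases h : x = τ c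
      · subst h
        rw [H.degIn_mate_of_max hc hdeg]
        norm_num
      · exact (H.degIn_nbr_of_max hc hdeg hx hcx h).le
    · rw [H.degIn_other_of_max hc hdeg hx hcx hxc]
      norm_num
  have h2' := H.two_le_degIn hy hx hxy.symm (fun h => hne (by rw [h, H.mate_mate y hy]))
  by_cases hcx : G.Adj c x
  · by_cases h : x = τ c
    · subst h
      rw [H.degIn_mate_of_max hc hdeg] at h2'
      omega
    · by_contra hyc
      have hs : ({c, y, τ x} : Finset V) ⊆ nbrsIn G S x := by
        intro z hz
        simp only [mem_insert, mem_singleton] at hz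
        rcases hz with rfl | rfl | rfl
        · exact mem_nbrsIn.2 ⟨hc, hcx.symm⟩
        · exact mem_nbrsIn.2 ⟨hy, hxy⟩
        · exact H.mate_mem_nbrsIn hx
      have h3 := card_le_card hs
      rw [card_insert_of_notMem, card_pair hne] at h3
      · unfold degIn at h2
        omega
      · simp only [mem_insert, mem_singleton, not_or]
        exact ⟨fun h => hyc h.symm, fun h' => h ((H.mate_eq_iff hx hc).1 h'.symm)⟩
  · rw [H.degIn_other_of_max hc hdeg hx hcx hxc] at h2'
    omega

lemma doubleChi_of_max (H : MatchedBicyclic G τ S m) (hm : 2 ≤ m) (hc : c ∈ S)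
    (hdeg : degIn G S c = m + 2) : doubleChi G S = 2 * chiMin m := by
  have hτc := H.mate_mem c hc
  have hcc := (H.adj_mate c hc).ne
  rw [H.doubleChi_eq]
  have h1 : ∑ x ∈ S, ∑ y ∈ (nbrsIn G S x).erase (τ x), edgeWeight (degIn G S x + degIn G S y) =
      (2 * m + 2) * edgeWeight (m + 4) := by
    rw [← H.sum_erase_const]
    refine sum_congr rfl fun x hx => sum_congr rfl fun y hy => ?_
    have hy' := mem_nbrsIn.1 (mem_of_mem_erase hy)
    have hyx := ne_of_mem_erase hy
    congr 1
    by_cases hxc : x = c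
    · subst hxc
      rw [hdeg, H.degIn_nbr_of_max hx hdeg hy'.1 hy'.2 hyx]
    · obtain rfl := H.eq_of_adj_of_max hc hdeg hx hy'.1 hy'.2 hxc hyx
      rw [hdeg, H.degIn_nbr_of_max hc hdeg hx hy'.2.symm]
      · ring
      · rintro rfl
        exact hyx (H.mate_mate y hc).symm
  have hsub : ({c, τ c} : Finset V) ⊆ S := by
    intro z hz
    rw [mem_insert, mem_singleton] at hz
    rcases hz with rfl | rfl <;> assumption
  have hle : ∀ x ∈ S \ {c, τ c}, degIn G S x ≤ 2 := by
    intro x hx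
    simp only [mem_sdiff, mem_insert, mem_singleton, not_or] at hx
    by_cases hcx : G.Adj c x
    · exact (H.degIn_nbr_of_max hc hdeg hx.1 hcx hx.2.2).le
    · rw [H.degIn_other_of_max hc hdeg hx.1 hcx hx.2.1]
      norm_num
  have hmate : ∀ x ∈ S \ {c, τ c}, τ x ∈ S \ {c, τ c} := by
    intro x hx
    simp only [mem_sdiff, mem_insert, mem_singleton, not_or] at hx ⊢
    refine ⟨H.mate_mem x hx.1, fun h => hx.2.2 ((H.mate_eq_iff hx.1 hc).1 h), fun h => hx.2.1 ?_⟩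
    rw [← H.mate_mate x hx.1, h, H.mate_mate c hc]
  have h2 : ∑ x ∈ S \ {c, τ c}, edgeWeight (degIn G S x + degIn G S (τ x)) =
      ∑ x ∈ S \ {c, τ c}, (1 / 2 + (4 - ((degIn G S x + degIn G S (τ x) : ℕ) : ℝ)) *
        (edgeWeight 3 - 1 / 2)) := by
    refine sum_congr rfl fun x hx => ?_
    have ha := H.three_le_pairDeg hm (mem_sdiff.1 hx).1
    have hb := hle x hx
    have hd := hle _ (hmate x hx)
    obtain h | h : degIn G S x + degIn G S (τ x) = 3 ∨ degIn G S x + degIn G S (τ x) = 4 := by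
      omega
    · rw [h]
      push_cast
      ring
    · rw [h, edgeWeight_four]
      push_cast
      ring
  have hcard : (#(S \ {c, τ c}) : ℝ) = 2 * m - 2 := by
    have h := card_sdiff_add_card_eq_card hsub
    rw [card_pair hcc, H.card] at h
    have : (#(S \ {c, τ c}) : ℝ) + 2 = 2 * m := by exact_mod_cast h
    linarith
  have hsum : ∑ x ∈ S \ {c, τ c}, ((degIn G S x + degIn G S (τ x) : ℕ) : ℝ) = 6 * m - 2 := by
    have h := H.sum_pairDeg
    rw [← sum_sdiff hsub, sum_pair hcc, H.mate_mate c hc, hdeg, H.degIn_mate_of_max hc hdeg] at h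
    have : ∑ x ∈ S \ {c, τ c}, (degIn G S x + degIn G S (τ x)) + 2 = 6 * m := by omega
    have h' : ((∑ x ∈ S \ {c, τ c}, (degIn G S x + degIn G S (τ x)) : ℕ) : ℝ) + 2 = 6 * m := by
      exact_mod_cast this
    rw [Nat.cast_sum] at h'
    linarith
  rw [h1, ← sum_sdiff hsub, h2, sum_pair hcc, H.mate_mate c hc, hdeg,
    H.degIn_mate_of_max hc hdeg, sum_add_distrib, ← sum_mul, sum_sub_distrib, hsum, sum_const,
    sum_const, nsmul_eq_mul, nsmul_eq_mul, hcard, add_comm 1 (m + 2), show m + 2 + 1 = m + 3 by ring]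
  unfold chiMin
  ring

end MaxDegree

section LargePairs

lemma card_filter_pairDeg_eq_four (H : MatchedBicyclic G τ S m)
    (h45 : ∀ x ∈ S, degIn G S x + degIn G S (τ x) = 4 ∨ degIn G S x + degIn G S (τ x) = 5) :
    #{x ∈ S | degIn G S x + degIn G S (τ x) = 4} + 4 = 2 * m := by
  have h := H.sum_pairDeg
  have h1 : ∀ x ∈ S, degIn G S x + degIn G S (τ x) +
      (if degIn G S x + degIn G S (τ x) = 4 then 1 else 0) = 5 := by
    intro x hx
    split_ifs <;> rcases h45 x hx with h | h <;> omega
  have h2 := sum_congr rfl h1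
  rw [sum_add_distrib, h, ← card_filter, sum_const, H.card, smul_eq_mul] at h2
  omega

lemma pairDeg_cases (H : MatchedBicyclic G τ S m)
    (h4 : ∀ x ∈ S, 4 ≤ degIn G S x + degIn G S (τ x)) :
    (∃ c ∈ S, degIn G S c + degIn G S (τ c) = 6 ∧
      ∀ z ∈ S, z ≠ c → z ≠ τ c → degIn G S z + degIn G S (τ z) = 4) ∨
    ∀ x ∈ S, degIn G S x + degIn G S (τ x) = 4 ∨ degIn G S x + degIn G S (τ x) = 5 := by
  by_cases h6 : ∃ c ∈ S, 6 ≤ degIn G S c + degIn G S (τ c)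
  · left
    obtain ⟨c, hc, hc6⟩ := h6
    have hcc := (H.adj_mate c hc).ne
    have hsub : ({c, τ c} : Finset V) ⊆ S := by
      intro z hz
      rw [mem_insert, mem_singleton] at hz
      rcases hz with rfl | rfl
      · exact hc
      · exact H.mate_mem _ hc
    have h := H.sum_pairDeg
    have hcard := card_sdiff_add_card_eq_card hsub
    rw [card_pair hcc, H.card] at hcard
    rw [← sum_sdiff hsub, sum_pair hcc, H.mate_mate c hc] at h
    have hle : ∑ x ∈ S \ {c, τ c}, 4 ≤ ∑ x ∈ S \ {c, τ c}, (degIn G S x + degIn G S (τ x)) :=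
      sum_le_sum fun x hx => h4 x (mem_sdiff.1 hx).1
    have heq : ∑ x ∈ S \ {c, τ c}, 4 = ∑ x ∈ S \ {c, τ c}, (degIn G S x + degIn G S (τ x)) := by
      rw [sum_const, smul_eq_mul] at hle ⊢
      omega
    refine ⟨c, hc, ?_, fun z hz h1 h2 => ?_⟩
    · rw [← heq, sum_const, smul_eq_mul] at h
      omega
    · exact ((sum_eq_sum_iff_of_le fun x hx => h4 x (mem_sdiff.1 hx).1).1 heq z
        (by simp [hz, h1, h2])).symm
  · right
    push Not at h6
    intro x hx
    have := h4 x hx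
    have := h6 x hx
    omega

lemma le_sum_mate_weight (H : MatchedBicyclic G τ S m) {e : ℝ}
    (he : ∀ x ∈ S, 1 / 2 - e * ((degIn G S x + degIn G S (τ x) : ℕ) - 4) ≤
      edgeWeight (degIn G S x + degIn G S (τ x))) :
    m - 4 * e ≤ ∑ x ∈ S, edgeWeight (degIn G S x + degIn G S (τ x)) := by
  refine le_trans (le_of_eq ?_) (sum_le_sum he)
  rw [sum_sub_distrib, ← mul_sum, sum_sub_distrib, ← Nat.cast_sum, H.sum_pairDeg, sum_const,
    sum_const, H.card]
  simp
  ring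

lemma le_sum_erase_weight (H : MatchedBicyclic G τ S m) {c k : ℝ} (hc : 0 ≤ c)
    (hk : ∀ x ∈ S, (((degIn G S x + degIn G S (τ x) : ℕ) : ℝ) - 4) *
      ((degIn G S x + degIn G S (τ x) : ℕ) - 2) ≤
        k * ((degIn G S x + degIn G S (τ x) : ℕ) - 4))
    (he : ∀ x ∈ S, ∀ y ∈ (nbrsIn G S x).erase (τ x),
      edgeWeight 6 - c * (((degIn G S x + degIn G S (τ x) : ℕ) - 4) +
        ((degIn G S y + degIn G S (τ y) : ℕ) - 4)) ≤ edgeWeight (degIn G S x + degIn G S y)) :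
    (2 * m + 2) * edgeWeight 6 - 4 * c * k ≤
      ∑ x ∈ S, ∑ y ∈ (nbrsIn G S x).erase (τ x), edgeWeight (degIn G S x + degIn G S y) := by
  refine le_trans ?_ (sum_le_sum fun x hx => sum_le_sum (he x hx))
  set T : V → ℝ := fun x => ((degIn G S x + degIn G S (τ x) : ℕ) : ℝ) - 4 with hT
  have hTτ : ∀ x ∈ S, T (τ x) = T x := by
    intro x hx
    simp only [hT, H.mate_mate x hx, add_comm]
  have hcomm : ∑ x ∈ S, ∑ y ∈ (nbrsIn G S x).erase (τ x), T y =
      ∑ x ∈ S, ∑ y ∈ (nbrsIn G S x).erase (τ x), T x := by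
    have h1 := sum_nbrsIn_comm (G := G) S (fun _ y => T y)
    rw [H.sum_nbrsIn_split, H.sum_nbrsIn_split, sum_congr rfl hTτ] at h1
    linarith
  have hcount : 2 * ∑ x ∈ S, ∑ y ∈ (nbrsIn G S x).erase (τ x), T x = ∑ x ∈ S, T x * (T x + 2) := by
    have h1 : ∑ x ∈ S, ∑ y ∈ (nbrsIn G S x).erase (τ x), T x =
        ∑ x ∈ S, T x * ((degIn G S x : ℝ) - 1) := by
      refine sum_congr rfl fun x hx => ?_
      rw [sum_const, nsmul_eq_mul, ← H.card_erase_mate hx]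
      push_cast
      ring
    have h2 := H.sum_mate (fun x => T x * ((degIn G S x : ℝ) - 1))
    rw [two_mul, h1]
    nth_rw 1 [← h2]
    rw [← sum_add_distrib]
    refine sum_congr rfl fun x hx => ?_
    rw [hTτ x hx]
    simp only [hT]
    push_cast
    ring
  have hsumT : ∑ x ∈ S, T x = 4 := by
    simp only [hT]
    rw [sum_sub_distrib, ← Nat.cast_sum, H.sum_pairDeg, sum_const, H.card]
    simp
    ring
  have hbound : ∑ x ∈ S, T x * (T x + 2) ≤ 4 * k := by
    calc _ ≤ ∑ x ∈ S, k * T x := by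
          refine sum_le_sum fun x hx => ?_
          have := hk x hx
          simp only [hT]
          linarith
      _ = 4 * k := by rw [← mul_sum, hsumT, mul_comm]
  change _ ≤ ∑ x ∈ S, ∑ y ∈ (nbrsIn G S x).erase (τ x), (edgeWeight 6 - c * (T x + T y))
  have hexp : ∑ x ∈ S, ∑ y ∈ (nbrsIn G S x).erase (τ x), (edgeWeight 6 - c * (T x + T y)) =
      (2 * m + 2) * edgeWeight 6 - c * (∑ x ∈ S, ∑ y ∈ (nbrsIn G S x).erase (τ x), T x +
        ∑ x ∈ S, ∑ y ∈ (nbrsIn G S x).erase (τ x), T y) := by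
    rw [← H.sum_erase_const, mul_add, mul_sum, mul_sum, ← sum_add_distrib, ← sum_sub_distrib]
    refine sum_congr rfl fun x _ => ?_
    rw [mul_sum, mul_sum, ← sum_add_distrib, ← sum_sub_distrib]
    exact sum_congr rfl fun y _ => by ring
  rw [hexp, hcomm]
  nlinarith

lemma degIn_add_one_le (H : MatchedBicyclic G τ S m) {x : V} (hx : x ∈ S) :
    degIn G S x + 1 ≤ degIn G S x + degIn G S (τ x) :=
  Nat.add_le_add_left (H.degIn_pos (H.mate_mem x hx)) _

lemma weight_le_of_pairDeg (H : MatchedBicyclic G τ S m) {x y : V} {p q : ℕ} (hx : x ∈ S)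
    (hy : y ∈ S) (hp : degIn G S x + degIn G S (τ x) = p)
    (hq : degIn G S y + degIn G S (τ y) = q) :
    edgeWeight (p + q - 2) ≤ edgeWeight (degIn G S x + degIn G S y) := by
  have h1 := H.degIn_add_one_le hx
  have h2 := H.degIn_add_one_le hy
  have h3 := H.degIn_pos hx
  exact edgeWeight_anti (by omega) (by omega)

lemma sum_mate_weight_of_six (H : MatchedBicyclic G τ S m)
    (h46 : ∀ x ∈ S, degIn G S x + degIn G S (τ x) = 4 ∨ degIn G S x + degIn G S (τ x) = 6) :
    m - 1 + 2 * edgeWeight 6 ≤ ∑ x ∈ S, edgeWeight (degIn G S x + degIn G S (τ x)) := by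
  have h := H.le_sum_mate_weight (e := (1 / 2 - edgeWeight 6) / 2) (by
    intro x hx
    rcases h46 x hx with h | h <;> rw [h]
    · rw [edgeWeight_four]
      norm_num
    · norm_num)
  linarith

lemma sum_mate_weight_of_five (H : MatchedBicyclic G τ S m)
    (h45 : ∀ x ∈ S, degIn G S x + degIn G S (τ x) = 4 ∨ degIn G S x + degIn G S (τ x) = 5) :
    m - 2 + 4 * edgeWeight 5 ≤ ∑ x ∈ S, edgeWeight (degIn G S x + degIn G S (τ x)) := by
  have h := H.le_sum_mate_weight (e := 1 / 2 - edgeWeight 5) (by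
    intro x hx
    rcases h45 x hx with h | h <;> rw [h]
    · rw [edgeWeight_four]
      norm_num
    · norm_num)
  linarith

/-- Without pendent paths of length two the bound is strict as soon as `4 ≤ m`. -/
lemma lt_doubleChi_of_four_le (H : MatchedBicyclic G τ S m) (hm : 4 ≤ m)
    (h4 : ∀ x ∈ S, 4 ≤ degIn G S x + degIn G S (τ x)) : 2 * chiMin m < doubleChi G S := by
  have hlin := chiMin_le_linear hm
  have hm' : (4 : ℝ) ≤ m := by exact_mod_cast hm
  have w5 : 0.44721 < edgeWeight 5 := lt_edgeWeight (by norm_num) (by norm_num) (by norm_num)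
  have w6 : edgeWeight 6 < 0.40825 := edgeWeight_lt (by norm_num) (by norm_num)
  have w6' : 0.40824 < edgeWeight 6 := lt_edgeWeight (by norm_num) (by norm_num) (by norm_num)
  have w7 : 0.37796 < edgeWeight 7 := lt_edgeWeight (by norm_num) (by norm_num) (by norm_num)
  have w7' : edgeWeight 7 < 0.37797 := edgeWeight_lt (by norm_num) (by norm_num)
  have w8 : 0.35355 < edgeWeight 8 := lt_edgeWeight (by norm_num) (by norm_num) (by norm_num)
  have w8' : edgeWeight 8 < 0.35356 := edgeWeight_lt (by norm_num) (by norm_num)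
  have w10 : 0.316 < edgeWeight 10 := lt_edgeWeight (by norm_num) (by norm_num) (by norm_num)
  rw [H.doubleChi_eq]
  rcases H.pairDeg_cases h4 with ⟨c, hc, hc6, hother⟩ | h45
  · have h46 : ∀ x ∈ S,
        degIn G S x + degIn G S (τ x) = 4 ∨ degIn G S x + degIn G S (τ x) = 6 := by
      intro x hx
      by_cases h1 : x = c
      · exact Or.inr (h1 ▸ hc6)
      · by_cases h2 : x = τ c
        · rw [h2, H.mate_mate c hc, add_comm]
          exact Or.inr hc6
        · exact Or.inl (hother x hx h1 h2)
    have hA := H.sum_mate_weight_of_six h46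
    have hB := H.le_sum_erase_weight (c := (edgeWeight 6 - edgeWeight 8) / 2) (k := 4)
      (by linarith)
      (by
        intro x hx
        rcases h46 x hx with h | h <;> rw [h] <;> norm_num)
      (by
        intro x hx y hy
        have hy' := (mem_nbrsIn.1 (mem_of_mem_erase hy)).1
        rcases h46 x hx with h | h <;> rcases h46 y hy' with h' | h' <;>
          have hw := H.weight_le_of_pairDeg hx hy' h h' <;> rw [h, h'] <;> norm_num at hw ⊢ <;>
          linarith)
    nlinarith
  · have hA := H.sum_mate_weight_of_five h45
    have hB := H.le_sum_erase_weight (c := edgeWeight 6 - edgeWeight 7) (k := 3)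
      (by linarith)
      (by
        intro x hx
        rcases h45 x hx with h | h <;> rw [h] <;> norm_num)
      (by
        intro x hx y hy
        have hy' := (mem_nbrsIn.1 (mem_of_mem_erase hy)).1
        rcases h45 x hx with h | h <;> rcases h45 y hy' with h' | h' <;>
          have hw := H.weight_le_of_pairDeg hx hy' h h' <;> rw [h, h'] <;> norm_num at hw ⊢ <;>
          linarith)
    nlinarith

end LargePairs

section SixVertices

lemma le_sum_erase_weight_three (H : MatchedBicyclic G τ S 3) :
    8 * edgeWeight 7 ≤
      ∑ x ∈ S, ∑ y ∈ (nbrsIn G S x).erase (τ x), edgeWeight (degIn G S x + degIn G S y) := by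
  rw [show (8 : ℝ) = 2 * (3 : ℕ) + 2 by norm_num, ← H.sum_erase_const]
  refine sum_le_sum fun x hx => sum_le_sum fun y hy => ?_
  have hy' := mem_nbrsIn.1 (mem_of_mem_erase hy)
  have := H.degIn_pos hx
  exact edgeWeight_anti (by omega) (H.degIn_add_le hx hy'.1 hy'.2)

/-- In a graph with six vertices, either every edge outside the matching has the largest possible
degree sum, or the edges outside the matching contribute strictly more than the minimum. -/
lemma erase_weight_three_cases (H : MatchedBicyclic G τ S 3) :
    (∀ x ∈ S, ∀ y ∈ S, G.Adj x y → y ≠ τ x → degIn G S x + degIn G S y = 7) ∨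
    7 * edgeWeight 7 + edgeWeight 6 ≤
      ∑ x ∈ S, ∑ y ∈ (nbrsIn G S x).erase (τ x), edgeWeight (degIn G S x + degIn G S y) := by
  by_cases hall : ∀ x ∈ S, ∀ y ∈ S, G.Adj x y → y ≠ τ x → degIn G S x + degIn G S y = 7
  · exact Or.inl hall
  right
  push Not at hall
  obtain ⟨x, hx, y, hy, hxy, hne, h7⟩ := hall
  have hnonneg : ∀ a ∈ S, ∀ b ∈ (nbrsIn G S a).erase (τ a),
      0 ≤ edgeWeight (degIn G S a + degIn G S b) - edgeWeight 7 := by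
    intro a ha b hb
    have hb' := mem_nbrsIn.1 (mem_of_mem_erase hb)
    have := H.degIn_pos ha
    exact sub_nonneg.2 (edgeWeight_anti (by omega) (H.degIn_add_le ha hb'.1 hb'.2))
  have h1 : edgeWeight (degIn G S x + degIn G S y) - edgeWeight 7 ≤
      ∑ b ∈ (nbrsIn G S x).erase (τ x),
        (edgeWeight (degIn G S x + degIn G S b) - edgeWeight 7) :=
    single_le_sum (f := fun b => edgeWeight (degIn G S x + degIn G S b) - edgeWeight 7)
      (hnonneg x hx) (mem_erase.2 ⟨hne, mem_nbrsIn.2 ⟨hy, hxy⟩⟩)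
  have h2 : ∑ b ∈ (nbrsIn G S x).erase (τ x),
        (edgeWeight (degIn G S x + degIn G S b) - edgeWeight 7) ≤
      ∑ a ∈ S, ∑ b ∈ (nbrsIn G S a).erase (τ a),
        (edgeWeight (degIn G S a + degIn G S b) - edgeWeight 7) :=
    single_le_sum (f := fun a => ∑ b ∈ (nbrsIn G S a).erase (τ a),
        (edgeWeight (degIn G S a + degIn G S b) - edgeWeight 7))
      (fun a ha => sum_nonneg (hnonneg a ha)) hx
  have h3 := H.sum_erase_const (edgeWeight 7)
  norm_num at h3
  simp only [sum_sub_distrib] at h2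
  have := H.degIn_pos hx
  have h6 : edgeWeight 6 ≤ edgeWeight (degIn G S x + degIn G S y) := by
    have := H.degIn_add_le hx hy hxy
    exact edgeWeight_anti (by omega) (by omega)
  simp only [sum_const, nsmul_eq_mul, sum_sub_distrib] at h1 h2 h3
  linarith

lemma exists_unmatched_nbr (H : MatchedBicyclic G τ S m) {x : V} (hx : x ∈ S)
    (h : 2 ≤ degIn G S x) : ∃ y ∈ S, G.Adj x y ∧ y ≠ τ x := by
  have := H.card_erase_mate hx
  obtain ⟨y, hy⟩ := card_pos.1 (show 0 < #((nbrsIn G S x).erase (τ x)) by omega)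
  have hy' := mem_nbrsIn.1 (mem_of_mem_erase hy)
  exact ⟨y, hy'.1, hy'.2, ne_of_mem_erase hy⟩

lemma exists_degIn_eq_five (H : MatchedBicyclic G τ S 3)
    (h7 : ∀ x ∈ S, ∀ y ∈ S, G.Adj x y → y ≠ τ x → degIn G S x + degIn G S y = 7)
    {c : V} (hc : c ∈ S) (hc6 : degIn G S c + degIn G S (τ c) = 6)
    (hother : ∀ z ∈ S, z ≠ c → z ≠ τ c → degIn G S z + degIn G S (τ z) = 4) :
    ∃ c ∈ S, degIn G S c = 3 + 2 := by
  have key : ∀ x ∈ S, (x = c ∨ x = τ c) → degIn G S x ≤ 3 → degIn G S x = 1 := by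
    intro x hx hxc h3
    by_contra h1
    have hpos := H.degIn_pos hx
    obtain ⟨y, hy, hxy, hne⟩ := H.exists_unmatched_nbr hx (by omega)
    have hsum := h7 x hx y hy hxy hne
    have hy4 : degIn G S y + degIn G S (τ y) = 4 := by
      rcases hxc with rfl | rfl
      · exact hother y hy hxy.ne' hne
      · rw [H.mate_mate c hc] at hne
        exact hother y hy hne hxy.ne'
    have := H.degIn_add_one_le hy
    omega
  rcases le_total (degIn G S c) 3 with h | h
  · have := key c hc (Or.inl rfl) h
    exact ⟨τ c, H.mate_mem c hc, by omega⟩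
  · have := key (τ c) (H.mate_mem c hc) (Or.inr rfl) (by omega)
    exact ⟨c, hc, by omega⟩

lemma not_forall_sum_eq_seven (H : MatchedBicyclic G τ S 3)
    (h45 : ∀ x ∈ S, degIn G S x + degIn G S (τ x) = 4 ∨ degIn G S x + degIn G S (τ x) = 5) :
    ¬ ∀ x ∈ S, ∀ y ∈ S, G.Adj x y → y ≠ τ x → degIn G S x + degIn G S y = 7 := by
  intro h7
  have hcard := H.card_filter_pairDeg_eq_four h45
  have hne2 : ∀ x ∈ S, degIn G S x ≠ 2 := by
    intro x hx h2
    obtain ⟨y, hy, hxy, hne⟩ := H.exists_unmatched_nbr hx h2.ge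
    have := h7 x hx y hy hxy hne
    have := H.degIn_add_one_le hy
    rcases h45 y hy with h | h <;> omega
  obtain ⟨a, ha, ha5⟩ : ∃ a ∈ S, degIn G S a + degIn G S (τ a) = 5 := by
    by_contra! hno
    rw [filter_true_of_mem fun x hx => (h45 x hx).resolve_right (hno x hx), H.card] at hcard
    omega
  obtain ⟨b, hb, hb4⟩ : ∃ b ∈ S, degIn G S b = 4 := by
    have h1 := hne2 a ha
    have h2 := hne2 _ (H.mate_mem a ha)
    have h3 := H.degIn_pos ha
    have h4 := H.degIn_pos (H.mate_mem a ha)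
    rcases show degIn G S a = 4 ∨ degIn G S (τ a) = 4 by omega with h | h
    · exact ⟨a, ha, h⟩
    · exact ⟨_, H.mate_mem a ha, h⟩
  have hsub : (nbrsIn G S b).erase (τ b) ⊆
      ({x ∈ S | degIn G S x + degIn G S (τ x) = 4} : Finset V) := by
    intro y hy
    have hy' := mem_nbrsIn.1 (mem_of_mem_erase hy)
    have hsum := h7 b hb y hy'.1 hy'.2 (ne_of_mem_erase hy)
    have := hne2 _ (H.mate_mem y hy'.1)
    refine mem_filter.2 ⟨hy'.1, ?_⟩
    rcases h45 y hy'.1 with h | h <;> omega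
  have := card_le_card hsub
  have := H.card_erase_mate hb
  omega

lemma chiMin_le_of_three (H : MatchedBicyclic G τ S 3) :
    2 * chiMin 3 ≤ doubleChi G S ∧
      (doubleChi G S = 2 * chiMin 3 → ∃ c ∈ S, degIn G S c = 3 + 2) := by
  have w3 : 0.57735 < edgeWeight 3 := lt_edgeWeight (by norm_num) (by norm_num) (by norm_num)
  have w5 : 0.44721 < edgeWeight 5 := lt_edgeWeight (by norm_num) (by norm_num) (by norm_num)
  have w5' : edgeWeight 5 < 0.44722 := edgeWeight_lt (by norm_num) (by norm_num)
  have w6 : edgeWeight 6 < 0.40825 := edgeWeight_lt (by norm_num) (by norm_num)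
  have w6' : 0.40824 < edgeWeight 6 := lt_edgeWeight (by norm_num) (by norm_num) (by norm_num)
  have w7 : edgeWeight 7 < 0.37797 := edgeWeight_lt (by norm_num) (by norm_num)
  have hmin : 2 * chiMin 3 = 8 * edgeWeight 7 + 2 * edgeWeight 6 + 2 := by
    unfold chiMin
    norm_num
    ring
  have hE := H.le_sum_erase_weight_three
  rw [H.doubleChi_eq, hmin]
  by_cases h4 : ∀ x ∈ S, 4 ≤ degIn G S x + degIn G S (τ x)
  · rcases H.pairDeg_cases h4 with ⟨c, hc, hc6, hother⟩ | h45
    · have h46 : ∀ x ∈ S,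
          degIn G S x + degIn G S (τ x) = 4 ∨ degIn G S x + degIn G S (τ x) = 6 := by
        intro x hx
        by_cases h1 : x = c
        · exact Or.inr (h1 ▸ hc6)
        · by_cases h2 : x = τ c
          · rw [h2, H.mate_mate c hc, add_comm]
            exact Or.inr hc6
          · exact Or.inl (hother x hx h1 h2)
      have hA := H.sum_mate_weight_of_six h46
      push_cast at hA
      refine ⟨by linarith, fun heq => ?_⟩
      rcases H.erase_weight_three_cases with h7 | hB
      · exact H.exists_degIn_eq_five h7 hc hc6 hother
      · linarith
    · have hA := H.sum_mate_weight_of_five h45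
      have hB := H.erase_weight_three_cases.resolve_left (H.not_forall_sum_eq_seven h45)
      push_cast at hA
      exact ⟨by linarith, fun heq => by linarith⟩
  · push Not at h4
    obtain ⟨x, hx, hx4⟩ := h4
    have hx3 : degIn G S x + degIn G S (τ x) = 3 := by
      have := H.three_le_pairDeg (by norm_num) hx
      omega
    have hxx := (H.adj_mate x hx).ne
    have hsub : ({x, τ x} : Finset V) ⊆ S := by
      intro z hz
      rw [mem_insert, mem_singleton] at hz
      rcases hz with rfl | rfl
      · exact hx
      · exact H.mate_mem _ hx
    have hcard := card_sdiff_add_card_eq_card hsub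
    rw [card_pair hxx, H.card] at hcard
    have hsum := H.sum_pairDeg
    rw [← sum_sdiff hsub, sum_pair hxx, H.mate_mate x hx, add_comm (degIn G S (τ x)), hx3] at hsum
    have hchord : ∑ z ∈ S \ {x, τ x}, (edgeWeight 5 -
        (((degIn G S z + degIn G S (τ z) : ℕ) : ℝ) - 5) * (edgeWeight 5 - edgeWeight 6)) ≤
        ∑ z ∈ S \ {x, τ x}, edgeWeight (degIn G S z + degIn G S (τ z)) := by
      refine sum_le_sum fun z hz => ?_
      have hz' := H.degIn_pos (mem_sdiff.1 hz).1
      have := chord_le_edgeWeight (a := 5) (n := degIn G S z + degIn G S (τ z)) (by norm_num)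
        (by omega)
      exact_mod_cast this
    have hcard' : #(S \ {x, τ x}) = 4 := by omega
    have hsum' : ∑ z ∈ S \ {x, τ x}, (degIn G S z + degIn G S (τ z)) = 22 := by omega
    rw [sum_sub_distrib, ← sum_mul, sum_sub_distrib, sum_const, sum_const, ← Nat.cast_sum, hcard',
      hsum'] at hchord
    have hA : ∑ z ∈ S, edgeWeight (degIn G S z + degIn G S (τ z)) =
        ∑ z ∈ S \ {x, τ x}, edgeWeight (degIn G S z + degIn G S (τ z)) + 2 * edgeWeight 3 := by
      rw [← sum_sdiff hsub, sum_pair hxx, H.mate_mate x hx, add_comm (degIn G S (τ x)), hx3]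
      ring
    norm_num at hchord
    exact ⟨by linarith, fun heq => by linarith⟩

end SixVertices

section PendentPath

variable {u w : V}

lemma nbrsIn_of_degIn_one (H : MatchedBicyclic G τ S m) (hu : u ∈ S) (hu1 : degIn G S u = 1) :
    nbrsIn G S u = {τ u} := by
  refine (eq_of_subset_of_card_le (singleton_subset_iff.2 (H.mate_mem_nbrsIn hu)) ?_).symm
  rw [card_singleton]
  exact hu1.le

lemma exists_nbrsIn_eq_pair (H : MatchedBicyclic G τ S m) (hu : u ∈ S)
    (hv2 : degIn G S (τ u) = 2) : ∃ w ∈ S, w ≠ u ∧ nbrsIn G S (τ u) = {u, w} := by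
  obtain ⟨w, hw, hvw, hne⟩ := H.exists_unmatched_nbr (H.mate_mem u hu) hv2.ge
  rw [H.mate_mate u hu] at hne
  refine ⟨w, hw, hne, (eq_of_subset_of_card_le ?_ ?_).symm⟩
  · intro z hz
    rw [mem_insert, mem_singleton] at hz
    rcases hz with rfl | rfl
    · exact mem_nbrsIn.2 ⟨hu, (H.adj_mate z hu).symm⟩
    · exact mem_nbrsIn.2 ⟨hw, hvw⟩
  · rw [card_pair hne.symm]
    exact hv2.le

/-- A pendent path of length two: `u` is pendent, its mate `τ u` has degree two, and the other
neighbour of `τ u` is `w`. -/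
structure PendentPath (G : SimpleGraph V) [DecidableRel G.Adj] (τ : V → V) (S : Finset V)
    (u w : V) : Prop where
  mem : u ∈ S
  mem_attach : w ∈ S
  attach_ne : w ≠ u
  nbrs_end : nbrsIn G S u = {τ u}
  nbrs_mid : nbrsIn G S (τ u) = {u, w}

lemma exists_pendentPath (H : MatchedBicyclic G τ S m) {x : V} (hx : x ∈ S)
    (h3 : degIn G S x + degIn G S (τ x) = 3) : ∃ u w, PendentPath G τ S u w := by
  have h1 := H.degIn_pos hx
  have h2 := H.degIn_pos (H.mate_mem x hx)
  obtain ⟨u, hu, hu1, hu2⟩ : ∃ u ∈ S, degIn G S u = 1 ∧ degIn G S (τ u) = 2 := by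
    rcases show degIn G S x = 1 ∨ degIn G S (τ x) = 1 by omega with h | h
    · exact ⟨x, hx, h, by omega⟩
    · exact ⟨τ x, H.mate_mem x hx, h, by rw [H.mate_mate x hx]; omega⟩
  obtain ⟨w, hw, hwu, hn⟩ := H.exists_nbrsIn_eq_pair hu hu2
  exact ⟨u, w, hu, hw, hwu, H.nbrsIn_of_degIn_one hu hu1, hn⟩

namespace PendentPath

lemma attach_ne_mate (P : PendentPath G τ S u w) : w ≠ τ u := by
  have h : w ∈ nbrsIn G S (τ u) := by simp [P.nbrs_mid]
  exact (mem_nbrsIn.1 h).2.ne'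

lemma adj_attach (P : PendentPath G τ S u w) : G.Adj (τ u) w := by
  have h : w ∈ nbrsIn G S (τ u) := by simp [P.nbrs_mid]
  exact (mem_nbrsIn.1 h).2

lemma attach_mem (P : PendentPath G τ S u w) : w ∈ S \ {u, τ u} := by
  simp [P.mem_attach, P.attach_ne, P.attach_ne_mate]

lemma not_adj_end (P : PendentPath G τ S u w) {x : V} (hx : x ∈ S \ {u, τ u}) : ¬ G.Adj x u := by
  simp only [mem_sdiff, mem_insert, mem_singleton, not_or] at hx
  intro h
  have : x ∈ nbrsIn G S u := mem_nbrsIn.2 ⟨hx.1, h.symm⟩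
  rw [P.nbrs_end, mem_singleton] at this
  exact hx.2.2 this

lemma eq_of_adj_mid (P : PendentPath G τ S u w) {x : V} (hx : x ∈ S \ {u, τ u})
    (h : G.Adj x (τ u)) : x = w := by
  simp only [mem_sdiff, mem_insert, mem_singleton, not_or] at hx
  have : x ∈ nbrsIn G S (τ u) := mem_nbrsIn.2 ⟨hx.1, h.symm⟩
  rw [P.nbrs_mid, mem_insert, mem_singleton] at this
  tauto

lemma nbrsIn_of_ne (P : PendentPath G τ S u w) {x : V} (hx : x ∈ S \ {u, τ u}) (hxw : x ≠ w) :
    nbrsIn G S x = nbrsIn G (S \ {u, τ u}) x := by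
  ext y
  simp only [mem_nbrsIn, mem_sdiff, mem_insert, mem_singleton, not_or]
  constructor
  · rintro ⟨h1, h2⟩
    refine ⟨⟨h1, ?_, ?_⟩, h2⟩
    · rintro rfl
      exact P.not_adj_end hx h2
    · rintro rfl
      exact hxw (P.eq_of_adj_mid hx h2)
  · tauto

lemma nbrsIn_attach (P : PendentPath G τ S u w) (hv : τ u ∈ S) :
    nbrsIn G S w = insert (τ u) (nbrsIn G (S \ {u, τ u}) w) := by
  ext y
  simp only [mem_nbrsIn, mem_sdiff, mem_insert, mem_singleton, not_or]
  constructor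
  · rintro ⟨h1, h2⟩
    by_cases h : y = τ u
    · exact Or.inl h
    · refine Or.inr ⟨⟨h1, ?_, h⟩, h2⟩
      rintro rfl
      exact P.not_adj_end P.attach_mem h2
  · rintro (rfl | h)
    · exact ⟨hv, P.adj_attach.symm⟩
    · tauto

lemma mid_notMem (S : Finset V) : τ u ∉ nbrsIn G (S \ {u, τ u}) w := by
  simp [mem_nbrsIn]

lemma degIn_of_ne (P : PendentPath G τ S u w) {x : V} (hx : x ∈ S \ {u, τ u}) (hxw : x ≠ w) :
    degIn G S x = degIn G (S \ {u, τ u}) x := by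
  rw [degIn, P.nbrsIn_of_ne hx hxw, degIn]

lemma degIn_attach (P : PendentPath G τ S u w) (hv : τ u ∈ S) :
    degIn G S w = degIn G (S \ {u, τ u}) w + 1 := by
  rw [degIn, P.nbrsIn_attach hv, card_insert_of_notMem (mid_notMem S), degIn]

lemma degIn_end (P : PendentPath G τ S u w) : degIn G S u = 1 := by
  rw [degIn, P.nbrs_end, card_singleton]

lemma degIn_mid (P : PendentPath G τ S u w) : degIn G S (τ u) = 2 := by
  rw [degIn, P.nbrs_mid, card_pair P.attach_ne.symm]

end PendentPath

lemma pair_subset (H : MatchedBicyclic G τ S m) (hu : u ∈ S) : {u, τ u} ⊆ S := by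
  intro z hz
  rw [mem_insert, mem_singleton] at hz
  rcases hz with rfl | rfl
  · exact hu
  · exact H.mate_mem _ hu

lemma sdiff_pendentPath (H : MatchedBicyclic G τ S (m + 1)) (P : PendentPath G τ S u w) :
    MatchedBicyclic G τ (S \ {u, τ u}) m := by
  have hu := P.mem
  have hv := H.mate_mem u hu
  have huv := (H.adj_mate u hu).ne
  have hsub := H.pair_subset hu
  have hS : ∀ x ∈ S \ {u, τ u}, x ∈ S := fun x hx => (mem_sdiff.1 hx).1
  refine ⟨?_, ?_, ?_, fun x hx => H.adj_mate x (hS x hx), fun x hx => H.mate_mate x (hS x hx), ?_⟩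
  · have h := card_sdiff_add_card_eq_card hsub
    rw [card_pair huv, H.card] at h
    omega
  · have h := H.sum_deg
    rw [← sum_sdiff hsub, sum_pair huv, P.degIn_end, P.degIn_mid,
      ← add_sum_erase _ _ P.attach_mem, P.degIn_attach hv,
      sum_congr rfl fun x hx => P.degIn_of_ne (mem_of_mem_erase hx) (ne_of_mem_erase hx)] at h
    rw [← add_sum_erase _ _ P.attach_mem]
    omega
  · intro x hx
    simp only [mem_sdiff, mem_insert, mem_singleton, not_or] at hx ⊢
    refine ⟨H.mate_mem x hx.1, fun h => hx.2.2 ((H.mate_eq_iff hx.1 hu).1 h), fun h => hx.2.1 ?_⟩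
    rw [← H.mate_mate x hx.1, h, H.mate_mate u hu]
  · intro A hA hne hAS
    have hAS' : A ⊆ S := hA.trans sdiff_subset
    have huA : u ∉ A := fun h => by simpa using hA h
    have hvA : τ u ∉ A := fun h => by simpa using hA h
    obtain ⟨y, hy, hyA⟩ := exists_of_ssubset (hA.ssubset_of_ne hAS)
    have hyS := hy
    simp only [mem_sdiff, mem_insert, mem_singleton, not_or] at hyS
    by_cases hwA : w ∈ A
    · obtain ⟨a, ha, b, hb, hab⟩ := H.exists_adj (A ∪ {u, τ u}) (union_subset hAS' hsub)
        (hne.mono subset_union_left)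
        (fun h => by
          have := h.symm ▸ hyS.1
          simp only [mem_union, mem_insert, mem_singleton] at this
          tauto)
      simp only [mem_sdiff, mem_union, mem_insert, mem_singleton, not_or] at ha hb
      have hb' : b ∈ S \ {u, τ u} := by simp [hb]
      rcases ha with ha | rfl | rfl
      · exact ⟨a, ha, b, mem_sdiff.2 ⟨hb', hb.2.1⟩, hab⟩
      · exact absurd hab.symm (P.not_adj_end hb')
      · exact absurd (P.eq_of_adj_mid hb' hab.symm ▸ hwA) hb.2.1
    · obtain ⟨a, ha, b, hb, hab⟩ := H.exists_adj A hAS' hne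
        (fun h => huA (h ▸ hu))
      rw [mem_sdiff] at hb
      refine ⟨a, ha, b, ?_, hab⟩
      simp only [mem_sdiff, mem_insert, mem_singleton, not_or]
      refine ⟨⟨hb.1, ?_, ?_⟩, hb.2⟩
      · rintro rfl
        exact P.not_adj_end (hA ha) hab
      · rintro rfl
        exact hwA (P.eq_of_adj_mid (hA ha) hab ▸ ha)

/-- Deleting a pendent path of length two: the change of the sum-connectivity index. -/
lemma doubleChi_sdiff (H : MatchedBicyclic G τ S (m + 1)) (P : PendentPath G τ S u w) :
    doubleChi G S = doubleChi G (S \ {u, τ u}) +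
      2 * (edgeWeight 3 + edgeWeight (degIn G S w + 2) +
        ∑ y ∈ nbrsIn G (S \ {u, τ u}) w, (edgeWeight (degIn G S w + degIn G S y) -
          edgeWeight (degIn G S w - 1 + degIn G S y))) := by
  have hu := P.mem
  have hv := H.mate_mem u hu
  have huv := (H.adj_mate u hu).ne
  have hsub := H.pair_subset hu
  have hw := P.attach_mem
  set S' := S \ {u, τ u} with hS'
  have hdw : degIn G S w - 1 = degIn G S' w := by
    rw [P.degIn_attach hv, Nat.add_sub_cancel]
  set E : V → ℝ := fun y => edgeWeight (degIn G S w + degIn G S y) -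
    edgeWeight (degIn G S w - 1 + degIn G S y) with hE
  have h1 : doubleChi G S = 2 * (edgeWeight 3 + edgeWeight (degIn G S w + 2)) +
      ∑ x ∈ S', ∑ y ∈ nbrsIn G S' x, edgeWeight (degIn G S x + degIn G S y) := by
    have hne : ∑ x ∈ S'.erase w, ∑ y ∈ nbrsIn G S x, edgeWeight (degIn G S x + degIn G S y) =
        ∑ x ∈ S'.erase w, ∑ y ∈ nbrsIn G S' x, edgeWeight (degIn G S x + degIn G S y) :=
      sum_congr rfl fun x hx => by
        rw [P.nbrsIn_of_ne (mem_of_mem_erase hx) (ne_of_mem_erase hx)]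
    unfold doubleChi
    rw [← sum_sdiff hsub, sum_pair huv, P.nbrs_end, P.nbrs_mid, sum_singleton,
      sum_pair P.attach_ne.symm, P.degIn_end, P.degIn_mid, ← hS', ← add_sum_erase _ _ hw,
      P.nbrsIn_attach hv, sum_insert (PendentPath.mid_notMem S), P.degIn_mid,
      ← add_sum_erase (a := w) S' (fun x => ∑ y ∈ nbrsIn G S' x,
        edgeWeight (degIn G S x + degIn G S y)) hw,
      hne, add_comm 2 (degIn G S w), ← hS']
    ring
  have h2 : ∀ x ∈ S', ∀ y ∈ nbrsIn G S' x, edgeWeight (degIn G S x + degIn G S y) =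
      edgeWeight (degIn G S' x + degIn G S' y) +
        ((if x = w then E y else 0) + (if y = w then E x else 0)) := by
    intro x hx y hy
    have hy' := mem_nbrsIn.1 hy
    by_cases hxw : x = w
    · subst hxw
      have hyx := hy'.2.ne'
      rw [if_pos rfl, if_neg hyx, ← hdw, ← P.degIn_of_ne hy'.1 hyx]
      simp only [hE]
      ring
    · rw [if_neg hxw, ← P.degIn_of_ne hx hxw]
      by_cases hyw : y = w
      · subst hyw
        rw [if_pos rfl, ← hdw]
        simp only [hE]
        rw [add_comm (degIn G S x), add_comm (degIn G S x)]
        ring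
      · rw [if_neg hyw, ← P.degIn_of_ne hy'.1 hyw]
        ring
  have h3 : ∑ x ∈ S', ∑ y ∈ nbrsIn G S' x, (if x = w then E y else 0) =
      ∑ y ∈ nbrsIn G S' w, E y := by
    rw [← add_sum_erase _ _ hw, sum_eq_zero (s := S'.erase w)]
    · simp
    · intro x hx
      simp [ne_of_mem_erase hx]
  have h4 := sum_nbrsIn_comm (G := G) S' (fun x y => if x = w then E y else 0)
  rw [h1, sum_congr rfl fun x hx => sum_congr rfl (h2 x hx)]
  simp only [sum_add_distrib]
  rw [← h4, h3]
  unfold doubleChi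
  ring

lemma le_doubleChi_of_pendentPath (H : MatchedBicyclic G τ S (m + 1))
    (P : PendentPath G τ S u w) :
    doubleChi G (S \ {u, τ u}) + 2 * (edgeWeight 3 + pathGain (degIn G S w)) ≤ doubleChi G S := by
  have hv := H.mate_mem u P.mem
  have H' := H.sdiff_pendentPath P
  rw [H.doubleChi_sdiff P, ← add_sum_erase _ _ (H'.mate_mem_nbrsIn P.attach_mem)]
  have hcard := H'.card_erase_mate P.attach_mem
  have hdw := P.degIn_attach hv
  obtain ⟨d, hd⟩ : ∃ d, degIn G S w = d + 2 := ⟨degIn G S w - 2, by omega⟩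
  rw [hd, show d + 2 - 1 = d + 1 by omega]
  have hgain : ∀ j k : ℕ, 0 < j → j ≤ k →
      edgeWeight (d + 2 + j) - edgeWeight (d + 1 + j) ≤
        edgeWeight (d + 2 + k) - edgeWeight (d + 1 + k) := by
    intro j k hj hjk
    have := edgeWeight_sub_succ_anti (a := d + 1 + j) (b := d + 1 + k) (by omega) (by omega)
    rw [show d + 2 + j = d + 1 + j + 1 by ring, show d + 2 + k = d + 1 + k + 1 by ring]
    linarith
  have hfirst := hgain 1 (degIn G S (τ w)) one_pos (H.degIn_pos (H.mate_mem w P.mem_attach))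
  have hrest : ∑ _y ∈ (nbrsIn G (S \ {u, τ u}) w).erase (τ w),
      (edgeWeight (d + 2 + 2) - edgeWeight (d + 1 + 2)) ≤
      ∑ y ∈ (nbrsIn G (S \ {u, τ u}) w).erase (τ w),
        (edgeWeight (d + 2 + degIn G S y) - edgeWeight (d + 1 + degIn G S y)) := by
    refine sum_le_sum fun y hy => hgain _ _ two_pos ?_
    have hy' := mem_nbrsIn.1 (mem_of_mem_erase hy)
    exact H.two_le_degIn P.mem_attach (mem_sdiff.1 hy'.1).1 hy'.2 (ne_of_mem_erase hy)
  rw [sum_const, nsmul_eq_mul, show #((nbrsIn G (S \ {u, τ u}) w).erase (τ w)) = d by omega]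
    at hrest
  unfold pathGain
  push_cast
  rw [show d + 1 + 2 = d + 2 + 1 by ring] at hrest
  rw [show d + 1 + 1 = d + 2 by ring] at hfirst
  linarith

end PendentPath

/-- The sum-connectivity index of a connected bicyclic graph with a perfect matching is at least
`chiMin m`, and equality forces a vertex of degree `m + 2`. -/
lemma chiMin_le (H : MatchedBicyclic G τ S m) (hm : 3 ≤ m) :
    2 * chiMin m ≤ doubleChi G S ∧
      (doubleChi G S = 2 * chiMin m → ∃ c ∈ S, degIn G S c = m + 2) := by
  induction m, hm using Nat.le_induction generalizing S with
  | base => exact H.chiMin_le_of_three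
  | succ m hm ih =>
    by_cases h4 : ∀ x ∈ S, 4 ≤ degIn G S x + degIn G S (τ x)
    · have h := H.lt_doubleChi_of_four_le (by omega) h4
      exact ⟨h.le, fun heq => absurd heq h.ne'⟩
    · push Not at h4
      obtain ⟨x, hx, hx4⟩ := h4
      have hx3 := H.three_le_pairDeg (by omega) hx
      obtain ⟨u, w, P⟩ := H.exists_pendentPath hx (by omega)
      have hstep := H.le_doubleChi_of_pendentPath P
      have hih := (ih (H.sdiff_pendentPath P)).1
      have hd2 : 2 ≤ degIn G S w :=
        H.two_le_degIn (H.mate_mem u P.mem) P.mem_attach P.adj_attach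
          (by rw [H.mate_mate u P.mem]; exact P.attach_ne)
      rw [chiMin_succ]
      rcases (H.degIn_le P.mem_attach).lt_or_eq with hlt | heq
      · have := pathGain_lt hd2 (show degIn G S w < m + 3 by omega)
        exact ⟨by linarith, fun heq => by linarith⟩
      · refine ⟨?_, fun _ => ⟨w, P.mem_attach, heq⟩⟩
        rw [heq, show m + 1 + 2 = m + 3 by ring] at hstep
        linarith

end MatchedBicyclic

section Univ

variable [Fintype V]

omit [DecidableEq V] in
lemma nbrsIn_univ (x : V) : nbrsIn G univ x = G.neighborFinset x := by
  ext y
  simp [mem_nbrsIn]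

omit [DecidableEq V] in
lemma degIn_univ (x : V) : degIn G univ x = G.degree x := by
  rw [degIn, nbrsIn_univ, SimpleGraph.card_neighborFinset_eq_degree]

lemma sum_nbrsIn_univ (F : Sym2 V → ℝ) :
    ∑ x, ∑ y ∈ nbrsIn G univ x, F s(x, y) = 2 * ∑ e ∈ G.edgeFinset, F e := by
  have h1 : ∑ d : G.Dart, F d.edge = 2 * ∑ e ∈ G.edgeFinset, F e := by
    rw [← sum_fiberwise_of_maps_to (s := univ) (t := G.edgeFinset) (g := SimpleGraph.Dart.edge)
      (fun d _ => SimpleGraph.mem_edgeFinset.2 d.edge_mem), mul_sum]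
    refine sum_congr rfl fun e he => ?_
    rw [sum_congr rfl fun d hd => by rw [(mem_filter.1 hd).2], sum_const,
      G.dart_edge_fiber_card e (SimpleGraph.mem_edgeFinset.1 he)]
    simp
  rw [← h1, sum_sigma']
  refine sum_bij' (fun p hp => ⟨(p.1, p.2), (mem_nbrsIn.1 (mem_sigma.1 hp).2).2⟩)
    (fun d _ => ⟨d.fst, d.snd⟩) ?_ ?_ ?_ ?_ ?_
  · simp
  · intro d _
    simp [mem_nbrsIn, d.adj]
  · simp
  · simp
  · intro p hp
    rfl

end Univ

end MatchedBicyclic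

lemma degR_eq_degIn {V : Type*} [Fintype V] (G : SimpleGraph V) [DecidableRel G.Adj] (x : V) :
    degR G x = degIn G Finset.univ x := by
  rw [degIn_univ, degR, Set.ncard_eq_toFinset_card', ← SimpleGraph.neighborFinset_def,
    SimpleGraph.card_neighborFinset_eq_degree]

lemma two_mul_sumConn {V : Type*} [Fintype V] [DecidableEq V] (G : SimpleGraph V)
    [DecidableRel G.Adj] : 2 * sumConn G = doubleChi G Finset.univ := by
  unfold sumConn doubleChi
  rw [show G.edgeSet.toFinite.toFinset = G.edgeFinset by ext; simp, ← sum_nbrsIn_univ]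
  refine Finset.sum_congr rfl fun x _ => Finset.sum_congr rfl fun y _ => ?_
  simp only [Sym2.lift_mk, edgeWeight, degR_eq_degIn, Nat.cast_add]

/-- A matching covering half as many edges as there are vertices yields an involution. -/
lemma exists_mate {V : Type*} [Fintype V] (G : SimpleGraph V) {m : ℕ}
    (hcard : Fintype.card V = 2 * m) (hmatch : matchingNumber G = m) :
    ∃ τ : V → V, (∀ x, G.Adj x (τ x)) ∧ ∀ x, τ (τ x) = x := by
  classical
  obtain ⟨M, hM, hpair, hncard⟩ : m ∈ {k | ∃ M : Set (Sym2 V), M ⊆ G.edgeSet ∧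
      M.Pairwise (fun e f => ∀ v, v ∈ e → v ∉ f) ∧ M.ncard = k} := by
    rw [← hmatch]
    refine Nat.sSup_mem ⟨0, ∅, by simp⟩ ⟨Nat.card (Sym2 V), ?_⟩
    rintro k ⟨M, -, -, rfl⟩
    exact Set.ncard_le_card M
  have hcover : (M.toFinset.biUnion fun e => e.toFinset) = Finset.univ := by
    rw [← Finset.card_eq_iff_eq_univ, Finset.card_biUnion, Finset.sum_congr rfl (g := fun _ => 2)]
    · rw [Finset.sum_const, ← Set.ncard_eq_toFinset_card', hncard, hcard, smul_eq_mul, mul_comm]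
    · intro e he
      exact Sym2.card_toFinset_of_not_isDiag e
        (G.not_isDiag_of_mem_edgeSet (hM (Set.mem_toFinset.1 he)))
    · intro e he f hf hef
      rw [Function.onFun, Finset.disjoint_left]
      intro v hv hv'
      exact hpair (Set.mem_toFinset.1 he) (Set.mem_toFinset.1 hf) hef v (Sym2.mem_toFinset.1 hv)
        (Sym2.mem_toFinset.1 hv')
  have hex : ∀ x, ∃ y, s(x, y) ∈ M := by
    intro x
    have hx : x ∈ M.toFinset.biUnion fun e => e.toFinset := hcover ▸ Finset.mem_univ x
    obtain ⟨e, he, hxe⟩ := Finset.mem_biUnion.1 hx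
    obtain ⟨y, rfl⟩ := Sym2.mem_iff_exists.1 (Sym2.mem_toFinset.1 hxe)
    exact ⟨y, Set.mem_toFinset.1 he⟩
  choose τ hτ using hex
  refine ⟨τ, fun x => hM (hτ x), fun x => ?_⟩
  have h : s(τ x, τ (τ x)) = s(x, τ x) := by
    by_contra hne
    exact hpair (hτ (τ x)) (hτ x) hne (τ x) (Sym2.mem_mk_left _ _) (Sym2.mem_mk_right _ _)
  rw [Sym2.eq_swap (a := x), Sym2.congr_right] at h
  exact h

lemma exists_matchedBicyclic {V : Type*} [Fintype V] [DecidableEq V] (G : SimpleGraph V)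
    [DecidableRel G.Adj] {m : ℕ} (hcard : Fintype.card V = 2 * m) (hconn : G.Connected)
    (hedges : G.edgeSet.ncard = 2 * m + 1) (hmatch : matchingNumber G = m) :
    ∃ τ, MatchedBicyclic G τ Finset.univ m := by
  obtain ⟨τ, hadj, hinv⟩ := exists_mate G hcard hmatch
  refine ⟨τ, hcard, ?_, fun _ _ => Finset.mem_univ _, fun x _ => hadj x, fun x _ => hinv x, ?_⟩
  · simp only [degIn_univ]
    rw [G.sum_degrees_eq_twice_card_edges, SimpleGraph.edgeFinset, ← Set.ncard_eq_toFinset_card',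
      hedges]
    ring
  · rintro A - ⟨a, ha⟩ hA
    obtain ⟨b, hb⟩ : ∃ b, b ∉ A := by
      by_contra! h
      exact hA (Finset.eq_univ_iff_forall.2 h)
    obtain ⟨p⟩ := hconn.preconnected a b
    obtain ⟨d, -, h1, h2⟩ := p.exists_boundary_dart (A : Set V) ha hb
    exact ⟨d.fst, h1, d.snd, by simpa using h2, d.adj⟩

section Extremal

variable {V : Type*} [Fintype V] [DecidableEq V] {G : SimpleGraph V} [DecidableRel G.Adj]
  {τ : V → V} {m : ℕ} {c : V}

/-- The perfect matching of `BnmGraph (2 * m) m`. -/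
def bnmMate (m : ℕ) : BnmVert (2 * m) m → BnmVert (2 * m) m
  | Sum.inl _ => Sum.inr (Sum.inr (Sum.inl 0))
  | Sum.inr (Sum.inl i) => Sum.inr (Sum.inl (![1, 0, 3, 2] i))
  | Sum.inr (Sum.inr (Sum.inl _)) => Sum.inl ()
  | Sum.inr (Sum.inr (Sum.inr (k, j))) => Sum.inr (Sum.inr (Sum.inr (k, 1 - j)))

lemma bnmGraph_adj_mate (m : ℕ) (a : BnmVert (2 * m) m) :
    (BnmGraph (2 * m) m).Adj a (bnmMate m a) := by
  unfold BnmGraph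
  rw [SimpleGraph.fromRel_adj]
  match a with
  | Sum.inl _ => exact ⟨Sum.inl_ne_inr, Or.inl trivial⟩
  | Sum.inr (Sum.inl i) =>
    refine ⟨fun h => ?_, ?_⟩
    · have hi : i = ![1, 0, 3, 2] i := Sum.inl_injective (Sum.inr_injective h)
      clear h
      revert i
      decide
    · change ((i = 0 ∧ ![1, 0, 3, 2] i = 1) ∨ (i = 2 ∧ ![1, 0, 3, 2] i = 3)) ∨
        ((![1, 0, 3, 2] i = 0 ∧ i = 1) ∨ (![1, 0, 3, 2] i = 2 ∧ i = 3))
      revert i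
      decide
  | Sum.inr (Sum.inr (Sum.inl _)) => exact ⟨Sum.inr_ne_inl, Or.inr trivial⟩
  | Sum.inr (Sum.inr (Sum.inr (k, j))) =>
    refine ⟨fun h => ?_, ?_⟩
    · have hj : j = 1 - j :=
        congrArg Prod.snd (Sum.inr_injective (Sum.inr_injective (Sum.inr_injective h)))
      clear h
      revert j
      decide
    · change (k = k ∧ j = 0 ∧ 1 - j = 1) ∨ (k = k ∧ 1 - j = 0 ∧ j = 1)
      revert j
      simp only [true_and]
      decide

/-- The map from the vertices of `BnmGraph (2 * m) m` sending the centre to `c`, the triangles to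
`c, p, τ p` and `c, q, τ q`, and the ends of the paths next to the centre to `e`. -/
def bnmMap (τ : V → V) (c p q : V) (e : Fin (m - 3) → V) : BnmVert (2 * m) m → V
  | Sum.inl _ => c
  | Sum.inr (Sum.inl i) => ![p, τ p, q, τ q] i
  | Sum.inr (Sum.inr (Sum.inl _)) => τ c
  | Sum.inr (Sum.inr (Sum.inr (k, j))) => ![e k, τ (e k)] j

omit [Fintype V] [DecidableEq V] in
lemma bnmMap_mate (hτ : ∀ x, τ (τ x) = x) (p q : V) (e : Fin (m - 3) → V)
    (a : BnmVert (2 * m) m) :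
    bnmMap τ c p q e (bnmMate m a) = τ (bnmMap τ c p q e a) := by
  match a with
  | Sum.inl _ => rfl
  | Sum.inr (Sum.inl i) => fin_cases i <;> simp [bnmMap, bnmMate, hτ]
  | Sum.inr (Sum.inr (Sum.inl _)) => simp [bnmMap, bnmMate, hτ]
  | Sum.inr (Sum.inr (Sum.inr (k, j))) => fin_cases j <;> simp [bnmMap, bnmMate, hτ]

lemma card_bnmVert (hm : 3 ≤ m) : Fintype.card (BnmVert (2 * m) m) = 2 * m := by
  change Fintype.card (Unit ⊕ Fin 4 ⊕ Fin (2 * m - 2 * m + 1) ⊕ (Fin (m - 3) × Fin 2)) = 2 * m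
  simp
  omega

namespace MatchedBicyclic

open Finset

lemma degIn_eq_of_iso (H : MatchedBicyclic G τ univ m) (hm : 3 ≤ m)
    (f : G ≃g BnmGraph (2 * m) m) : degIn G univ (f.symm (Sum.inl ())) = m + 2 := by
  refine le_antisymm (H.degIn_le (mem_univ _)) ?_
  let ψ : Fin 4 ⊕ Fin (2 * m - 2 * m + 1) ⊕ Fin (m - 3) → BnmVert (2 * m) m :=
    fun y => Sum.inr (Sum.map id (Sum.map id fun k => (k, 0)) y)
  have hψ : Function.Injective ψ :=
    Sum.inr_injective.comp (Sum.map_injective.2 ⟨Function.injective_id,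
      Sum.map_injective.2 ⟨Function.injective_id, fun a b h => congrArg Prod.fst h⟩⟩)
  have hadj : ∀ y, (BnmGraph (2 * m) m).Adj (Sum.inl ()) (ψ y) := by
    intro y
    refine (SimpleGraph.fromRel_adj _ _ _).2 ⟨Sum.inl_ne_inr, Or.inl ?_⟩
    rcases y with i | t | k
    · trivial
    · trivial
    · exact (rfl : (0 : Fin 2) = 0)
  have hcard := card_le_card_of_injOn (s := univ) (t := nbrsIn G univ (f.symm (Sum.inl ())))
    (fun y => f.symm (ψ y)) (fun y _ => mem_nbrsIn.2 ⟨mem_univ _, f.symm.map_rel_iff.2 (hadj y)⟩)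
    ((f.symm.injective.comp hψ).injOn)
  refine le_trans (le_of_eq ?_) hcard
  simp
  omega

/-- A vertex of degree `m + 2` determines the graph up to isomorphism. -/
lemma nonempty_iso_of_max (H : MatchedBicyclic G τ univ m) (hm : 3 ≤ m)
    (hdeg : degIn G univ c = m + 2) : Nonempty (G ≃g BnmGraph (2 * m) m) := by
  have hτ : ∀ x, τ (τ x) = x := fun x => H.mate_mate x (mem_univ x)
  have hadj : ∀ x, G.Adj x (τ x) := fun x => H.adj_mate x (mem_univ x)
  have hinj : Function.Injective τ := Function.Involutive.injective hτ
  set N := (nbrsIn G univ c).erase (τ c) with hN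
  have hmemN : ∀ x, x ∈ N ↔ x ≠ τ c ∧ G.Adj c x := by simp [hN, mem_nbrsIn]
  have hcardN : #N = m + 1 := by
    have : #N + 1 = degIn G univ c := H.card_erase_mate (mem_univ c)
    omega
  have hcN : c ∉ N := by simp [hmemN]
  have hτcN : τ c ∉ N := by simp [hmemN]
  set O := univ \ insert c (insert (τ c) N) with hO
  have hmemO : ∀ x, x ∈ O ↔ x ≠ c ∧ x ≠ τ c ∧ x ∉ N := by simp [hO]
  have hcardO : #O + (m + 3) = 2 * m := by
    rw [← H.card, ← card_sdiff_add_card_eq_card (subset_univ (insert c (insert (τ c) N))),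
      card_insert_of_notMem (by simp [(hadj c).ne, hcN]), card_insert_of_notMem hτcN, hcardN]
  have hOτ : ∀ x ∈ O, τ x ∈ N := by
    intro x hx
    obtain ⟨h1, h2, h3⟩ := (hmemO x).1 hx
    have hne : τ x ≠ τ c := fun h => h1 (hinj h)
    refine (hmemN _).2 ⟨hne, ?_⟩
    by_contra hcx
    have hcx' : ¬ G.Adj c x := fun h => h3 ((hmemN x).2 ⟨h2, h⟩)
    have hd := H.three_le_pairDeg (by omega) (mem_univ x)
    rw [H.degIn_other_of_max (mem_univ c) hdeg (mem_univ _) hcx' h1,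
      H.degIn_other_of_max (mem_univ c) hdeg (mem_univ _) hcx
        (fun h => h2 (by rw [← h, hτ]))] at hd
    omega
  set P := {x ∈ N | τ x ∉ N} with hP
  have hcardP : #P = m - 3 := by
    have : #P = #O := by
      refine card_nbij' τ τ ?_ ?_ (fun x _ => hτ x) (fun x _ => hτ x)
      · intro x hx
        obtain ⟨h1, h2⟩ := mem_filter.1 hx
        refine (hmemO _).2 ⟨fun h => hτcN ?_, fun h => hcN ?_, h2⟩
        · rwa [← h, hτ]
        · rwa [← hinj h]
      · intro x hx
        refine mem_filter.2 ⟨hOτ x hx, ?_⟩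
        rw [hτ]
        exact ((hmemO x).1 hx).2.2
    omega
  set A := {x ∈ N | τ x ∈ N} with hA
  have hcardA : #A = 4 := by
    have : #A + #P = #N := card_filter_add_card_filter_not (s := N) (fun x => τ x ∈ N)
    omega
  have hAτ : ∀ x ∈ A, τ x ∈ A := by
    intro x hx
    obtain ⟨h1, h2⟩ := mem_filter.1 hx
    exact mem_filter.2 ⟨h2, by rwa [hτ]⟩
  obtain ⟨p, hp⟩ := card_pos.1 (show 0 < #A by omega)
  obtain ⟨q, hq⟩ : (A \ {p, τ p}).Nonempty := by
    rw [← card_pos]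
    have := le_card_sdiff {p, τ p} A
    have : #{p, τ p} ≤ 2 := card_le_two
    omega
  simp only [mem_sdiff, mem_insert, mem_singleton, not_or] at hq
  have hAeq : ({p, τ p, q, τ q} : Finset V) = A := by
    refine eq_of_subset_of_card_le ?_ ?_
    · intro z hz
      simp only [mem_insert, mem_singleton] at hz
      rcases hz with rfl | rfl | rfl | rfl
      · exact hp
      · exact hAτ _ hp
      · exact hq.1
      · exact hAτ _ hq.1
    · have h1 : p ≠ τ q := fun h => hq.2.2 (by rw [h, hτ])
      have h2 : τ p ≠ τ q := fun h => hq.2.1 (hinj h).symm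
      rw [hcardA, card_insert_of_notMem, card_insert_of_notMem, card_pair (hadj q).ne]
      · simp [h2, Ne.symm hq.2.2]
      · simp [h1, (hadj p).ne, Ne.symm hq.2.1]
  have hAN : ∀ x ∈ A, G.Adj c x := fun x hx => ((hmemN x).1 (mem_filter.1 hx).1).2
  let e := (P.equivFinOfCardEq hcardP).symm
  have he : ∀ k, (e k : V) ∈ N ∧ τ (e k) ∉ N := fun k => mem_filter.1 (e k).2
  let φ : BnmVert (2 * m) m → V := bnmMap τ c p q fun k => e k
  have hsurj : Function.Surjective φ := by
    intro x
    by_cases h1 : x = c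
    · exact ⟨Sum.inl (), h1.symm⟩
    by_cases h2 : x = τ c
    · exact ⟨Sum.inr (Sum.inr (Sum.inl 0)), h2.symm⟩
    by_cases h3 : x ∈ N
    · by_cases h4 : τ x ∈ N
      · have hxA : x ∈ A := mem_filter.2 ⟨h3, h4⟩
        rw [← hAeq] at hxA
        simp only [mem_insert, mem_singleton] at hxA
        rcases hxA with rfl | rfl | rfl | rfl
        · exact ⟨Sum.inr (Sum.inl 0), rfl⟩
        · exact ⟨Sum.inr (Sum.inl 1), rfl⟩
        · exact ⟨Sum.inr (Sum.inl 2), rfl⟩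
        · exact ⟨Sum.inr (Sum.inl 3), rfl⟩
      · obtain ⟨k, hk⟩ := e.surjective ⟨x, mem_filter.2 ⟨h3, h4⟩⟩
        exact ⟨Sum.inr (Sum.inr (Sum.inr (k, 0))), congrArg Subtype.val hk⟩
    · have hxO : x ∈ O := (hmemO x).2 ⟨h1, h2, h3⟩
      obtain ⟨k, hk⟩ := e.surjective ⟨τ x, mem_filter.2 ⟨hOτ x hxO, by rwa [hτ]⟩⟩
      refine ⟨Sum.inr (Sum.inr (Sum.inr (k, 1))), ?_⟩
      change τ (e k) = x
      rw [hk, hτ]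
  have hbij : Function.Bijective φ := by
    rw [Fintype.bijective_iff_surjective_and_card, card_bnmVert hm]
    exact ⟨hsurj, H.card.symm⟩
  have hmate : ∀ a, φ (bnmMate m a) = τ (φ a) := bnmMap_mate hτ p q _
  have hrel : ∀ a b, BnmRel (2 * m) m a b → G.Adj (φ a) (φ b) := by
    intro a b hab
    match a, b, hab with
    | Sum.inl _, Sum.inr (Sum.inl i), _ =>
      refine hAN _ (hAeq ▸ ?_)
      fin_cases i <;> simp [φ, bnmMap]
    | Sum.inl _, Sum.inr (Sum.inr (Sum.inl _)), _ => exact hadj c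
    | Sum.inl _, Sum.inr (Sum.inr (Sum.inr (k, j))), hj =>
      obtain rfl : j = 0 := hj
      exact ((hmemN _).1 (he k).1).2
    | Sum.inr (Sum.inl i), Sum.inr (Sum.inl i'), hi =>
      rcases (hi : (i = 0 ∧ i' = 1) ∨ (i = 2 ∧ i' = 3)) with ⟨rfl, rfl⟩ | ⟨rfl, rfl⟩
      · exact hadj p
      · exact hadj q
    | Sum.inr (Sum.inr (Sum.inr (k, j))), Sum.inr (Sum.inr (Sum.inr (k', j'))), hk =>
      obtain ⟨rfl, rfl, rfl⟩ : k = k' ∧ j = 0 ∧ j' = 1 := hk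
      exact hadj _
  have hcentre : ∀ a, φ a = c → a = Sum.inl () := fun a ha => hbij.1 ha
  have hnbr : ∀ b, G.Adj c (φ b) → (BnmGraph (2 * m) m).Adj (Sum.inl ()) b := by
    intro b hb
    refine (SimpleGraph.fromRel_adj _ _ _).2 ?_
    match b with
    | Sum.inl _ => exact absurd hb (G.irrefl)
    | Sum.inr (Sum.inl i) => exact ⟨Sum.inl_ne_inr, Or.inl trivial⟩
    | Sum.inr (Sum.inr (Sum.inl _)) => exact ⟨Sum.inl_ne_inr, Or.inl trivial⟩
    | Sum.inr (Sum.inr (Sum.inr (k, j))) =>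
      refine ⟨Sum.inl_ne_inr, Or.inl ?_⟩
      change j = 0
      by_contra hj
      obtain rfl : j = 1 := by omega
      refine (he k).2 ((hmemN _).2 ⟨fun h => hcN ?_, hb⟩)
      rw [← hinj h]
      exact (he k).1
  refine ⟨(SimpleGraph.Iso.symm ⟨Equiv.ofBijective φ hbij, ?_⟩)⟩
  intro a b
  change G.Adj (φ a) (φ b) ↔ _
  constructor
  · intro h
    by_cases hac : φ a = c
    · rw [hcentre a hac]
      exact hnbr b (hac ▸ h)
    · by_cases hb : φ b = τ (φ a)
      · rw [← hmate] at hb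
        rw [hbij.1 hb]
        exact bnmGraph_adj_mate m a
      · have hbc := H.eq_of_adj_of_max (mem_univ c) hdeg (mem_univ _) (mem_univ _) h hac hb
        rw [hcentre b hbc]
        exact (hnbr a (hbc ▸ h.symm)).symm
  · intro h
    rw [BnmGraph, SimpleGraph.fromRel_adj] at h
    rcases h.2 with h | h
    · exact hrel a b h
    · exact (hrel b a h).symm

end MatchedBicyclic

end Extremal

/-- Let `G` be a bicyclic graph with `2m` vertices and matching number `m`
(i.e. with a perfect matching), where `m ≥ 3`. Then
`χ(G) ≥ (m+1)/√(m+4) + 1/√(m+3) + (m−3)/√3 + 1`, with equality if and only if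
`G ≅ B_{2m,m}`. -/
theorem stmt_5 {V : Type*} [Fintype V] (G : SimpleGraph V) (m : ℕ) (hm : 3 ≤ m)
    (hcard : Fintype.card V = 2 * m) (hconn : G.Connected)
    (hedges : G.edgeSet.ncard = 2 * m + 1)
    (hmatch : matchingNumber G = m) :
    sumConn G ≥ ((m : ℝ) + 1) / Real.sqrt ((m : ℝ) + 4) + 1 / Real.sqrt ((m : ℝ) + 3) +
        ((m : ℝ) - 3) / Real.sqrt 3 + 1 ∧
    (sumConn G = ((m : ℝ) + 1) / Real.sqrt ((m : ℝ) + 4) + 1 / Real.sqrt ((m : ℝ) + 3) +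
        ((m : ℝ) - 3) / Real.sqrt 3 + 1 ↔
      Nonempty (G ≃g BnmGraph (2 * m) m)) := by
  classical
  obtain ⟨τ, H⟩ := exists_matchedBicyclic G hcard hconn hedges hmatch
  have hval : ((m : ℝ) + 1) / Real.sqrt ((m : ℝ) + 4) + 1 / Real.sqrt ((m : ℝ) + 3) +
      ((m : ℝ) - 3) / Real.sqrt 3 + 1 = chiMin m := by
    unfold chiMin edgeWeight
    push_cast
    ring
  have hsum := two_mul_sumConn G
  obtain ⟨hle, heq⟩ := H.chiMin_le hm
  rw [hval]
  refine ⟨by linarith, fun h => ?_, fun ⟨f⟩ => ?_⟩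
  · obtain ⟨c, -, hc⟩ := heq (by linarith)
    exact H.nonempty_iso_of_max hm hc
  · have := H.doubleChi_of_max (by omega) (Finset.mem_univ _) (H.degIn_eq_of_iso hm f)
    linarith
end
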